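/- arXiv:2305.01745 — 3 statements merged into one kernel-verified Lean document; each statement's English description precedes it below -/
import Mathlib

section
/- For any A > 1, any λ ∈ [0,1], any n₀ ∈ ℕ, and any sequence (α_n)_{n∈ℕ} of positive reals converging to 0, there exist n ∈ ℕ with n ≥ n₀ and a continuous function f = f_n on I such that f ≥ 0 on I, f ≡ 0 on [-1, -1/2], and for every polynomial P_n of degree ≤ n which is nonnegative in some nonempty open neighborhood of λ and satisfies P_n(λ) = f(λ), one has sup_{x ∈ I} |f(x) - P_n(x)| / ω₃(f, ρ_n(x)) > A α_n √n. -/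
/-- The `k`-th modulus of smoothness of `g` with step bound `t` on `[a,b]`. -/
noncomputable def omegaK (g : ℝ → ℝ) (k : ℕ) (t a b : ℝ) : ℝ :=
  sSup {v : ℝ | ∃ h x : ℝ, 0 < h ∧ h ≤ t ∧ a ≤ x ∧ x + (k : ℝ) * h ≤ b ∧
    v = |∑ i ∈ Finset.range (k + 1),
      (-1 : ℝ) ^ (k - i) * (k.choose i : ℝ) * g (x + (i : ℝ) * h)|}

/-- `ρ_n(x) = n⁻¹ √(1 - x²) + n⁻²`. -/
noncomputable def rho (n : ℕ) (x : ℝ) : ℝ :=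
  Real.sqrt (1 - x ^ 2) / n + 1 / (n : ℝ) ^ 2

open Polynomial in
/-- Markov's inequality for the derivative at the right endpoint. -/
lemma abs_derivative_eval_one_le {D : ℝ[X]} {n : ℕ} {ε : ℝ} (hD : D.natDegree ≤ n)
    (hε : 0 < ε) (hb : ∀ x ∈ Set.Icc (-1 : ℝ) 1, |D.eval x| ≤ ε) :
    |(derivative D).eval 1| ≤ n ^ 2 * ε := by
  have key : ∀ Q : ℝ[X], Q.natDegree ≤ n → (∀ x ∈ Set.Icc (-1 : ℝ) 1, |Q.eval x| ≤ ε) →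
      (derivative Q).eval 1 ≤ n ^ 2 * ε := by
    intro Q hQ hQb
    have h := Chebyshev.eval_iterate_derivative_le_of_forall_abs_le_one (n := n)
      (P := C ε⁻¹ * Q) (k := 1) (x := 1) le_rfl
      (degree_le_of_natDegree_le ((natDegree_C_mul_le _ _).trans hQ)) (by
        intro x hx
        rw [eval_mul, eval_C, abs_mul, abs_of_pos (inv_pos.2 hε)]
        calc ε⁻¹ * |Q.eval x| ≤ ε⁻¹ * ε := by gcongr; exact hQb x hx
          _ = 1 := inv_mul_cancel₀ hε.ne')
    have h1 := Chebyshev.iterate_derivative_T_eval_one (R := ℝ) n 1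
    simp only [Finset.prod_range_one] at h1
    norm_num at h1 h
    rw [h1] at h
    calc _ = ε * (ε⁻¹ * (derivative Q).eval 1) := by field_simp
      _ ≤ ε * n ^ 2 := by gcongr
      _ = _ := mul_comm _ _
  refine abs_le'.2 ⟨key D hD hb, ?_⟩
  have := key (-D) (by simpa using hD) (by simpa using hb)
  simpa using this

open Polynomial in
lemma exists_expand_two_of_comp_neg {Q : ℝ[X]} (hQ : Q.comp (-X) = Q) {n : ℕ}
    (hn : Q.natDegree ≤ 2 * n) :
    ∃ G : ℝ[X], G.natDegree ≤ n ∧ expand ℝ 2 G = Q := by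
  have hodd : ∀ k, ¬ 2 ∣ k → Q.coeff k = 0 := by
    intro k hk
    have h := congrArg (fun p => coeff p k) hQ
    have hX : (-X : ℝ[X]) = C (-1) * X := by simp
    simp only [hX, comp_C_mul_X_coeff] at h
    rw [(Nat.odd_iff.2 (by omega)).neg_one_pow] at h
    linarith
  refine ⟨contract 2 Q, ?_, ?_⟩
  · rw [natDegree_le_iff_coeff_eq_zero]
    intro k hk
    rw [coeff_contract two_ne_zero]
    exact coeff_eq_zero_of_natDegree_lt (by omega)
  · ext k
    rw [coeff_expand two_pos]
    split_ifs with h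
    · rw [coeff_contract two_ne_zero, Nat.div_mul_cancel h]
    · exact (hodd k h).symm

open Polynomial in
/-- A Bernstein-type inequality at a point of `[0, 1)`. -/
lemma abs_derivative_eval_le {D : ℝ[X]} {n : ℕ} {ε t : ℝ} (hD : D.natDegree ≤ n)
    (hε : 0 < ε) (ht : t ∈ Set.Ico (0 : ℝ) 1)
    (hb : ∀ x ∈ Set.Icc (-1 : ℝ) 1, |D.eval x| ≤ ε) :
    |(derivative D).eval t| ≤ 2 * n * ε / (1 - t) := by
  obtain ⟨ht0, ht1⟩ := ht
  set c := 1 - t with hc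
  have hc0 : 0 < c := by linarith
  set Q : ℝ[X] := D.comp (C t + C c * X) - D.comp (C t - C c * X) with hQ
  have hneg : Q.comp (-X) = -Q := by
    simp only [hQ, sub_comp, comp_assoc, add_comp, mul_comp, C_comp, X_comp, mul_neg, sub_neg_eq_add,
      ← sub_eq_add_neg, neg_sub]
  have hQd : Q.natDegree ≤ n := by
    have hlin : ∀ p : ℝ[X], p.natDegree ≤ 1 → (D.comp p).natDegree ≤ n := fun p hp =>
      natDegree_comp_le.trans ((Nat.mul_le_mul hD hp).trans (by simp))
    refine (natDegree_sub_le _ _).trans (max_le (hlin _ ?_) (hlin _ ?_)) <;> compute_degree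
  have hQ2 : (Q ^ 2).comp (-X) = Q ^ 2 := by rw [pow_comp, hneg]; ring
  obtain ⟨G, hG, hGQ⟩ := exists_expand_two_of_comp_neg hQ2 (n := n) (natDegree_pow_le_of_le 2 hQd)
  have hQb : ∀ x ∈ Set.Icc (0 : ℝ) 1, |Q.eval x| ≤ 2 * ε := by
    intro x ⟨hx0, hx1⟩
    have h1 := hb (t + c * x) ⟨by nlinarith, by nlinarith⟩
    have h2 := hb (t - c * x) ⟨by nlinarith, by nlinarith⟩
    simp only [hQ, eval_sub, eval_comp, eval_add, eval_mul, eval_C, eval_X]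
    exact (abs_sub _ _).trans (by linarith)
  have hGe : ∀ x : ℝ, G.eval (x ^ 2) = (Q.eval x) ^ 2 := by
    intro x; rw [← eval_pow, ← hGQ, expand_eval]
  have hM := abs_derivative_eval_one_le (D := G.comp (C (1 / 2) * (1 - X))) (n := n)
    (ε := (2 * ε) ^ 2)
    (natDegree_comp_le.trans ((Nat.mul_le_mul hG (by compute_degree)).trans (mul_one n).le))
    (by positivity) (by
      intro x ⟨hx0, hx1⟩
      have hs : 0 ≤ 1 / 2 * (1 - x) := by linarith
      have := hGe (Real.sqrt (1 / 2 * (1 - x)))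
      rw [Real.sq_sqrt hs] at this
      simp only [eval_comp, eval_mul, eval_C, eval_sub, eval_one, eval_X, this]
      rw [abs_pow]
      gcongr
      exact hQb _ ⟨Real.sqrt_nonneg _, Real.sqrt_le_one.2 (by linarith)⟩)
  have hd : (derivative G).eval 0 = ((derivative Q).eval 0) ^ 2 := by
    have hQ0 : Q.eval 0 = 0 := by simp [hQ]
    have hX : X ∣ Q := X_dvd_iff.2 (by rwa [coeff_zero_eq_eval_zero])
    rw [← coeff_zero_eq_eval_zero, ← coeff_zero_eq_eval_zero, coeff_derivative, coeff_derivative]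
    obtain ⟨S, hS⟩ := hX
    have h2 : G.coeff 1 = (Q ^ 2).coeff 2 := by
      rw [← hGQ, coeff_expand two_pos]; simp
    rw [zero_add, h2, hS, mul_pow]
    have : (X ^ 2 * S ^ 2 : ℝ[X]).coeff 2 = (S ^ 2).coeff 0 := coeff_X_pow_mul (S ^ 2) 2 0
    rw [this, coeff_X_mul S 0]
    simp [coeff_zero_eq_eval_zero]
  have hdQ : (derivative Q).eval 0 = 2 * c * (derivative D).eval t := by
    simp [hQ, derivative_comp]; ring
  have hcalc : (derivative (G.comp (C (1 / 2) * (1 - X)))).eval 1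
      = -(1 / 2) * (derivative G).eval 0 := by
    simp [derivative_comp]
  rw [hcalc, hd, hdQ, abs_mul, abs_pow, ← sq_abs] at hM
  norm_num at hM
  rw [abs_of_pos hc0] at hM
  rw [le_div_iff₀ hc0]
  have h0 : 0 ≤ |(derivative D).eval t| * c := by positivity
  refine abs_le_of_sq_le_sq' ?_ (by positivity) |>.2
  nlinarith [sq_nonneg (|(derivative D).eval t| * c)]

open Polynomial in
/-- A maximum principle for the differential operator `7 - y d/dy` on `[0, 1]`. -/
lemma eval_le_of_euler_le {p : ℝ[X]} {B : ℝ} (h1 : 7 * p.eval 1 ≤ B)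
    (h : ∀ y ∈ Set.Icc (0 : ℝ) 1, 7 * p.eval y - y * (derivative p).eval y ≤ B) :
    ∀ y ∈ Set.Icc (0 : ℝ) 1, 7 * p.eval y ≤ B := by
  obtain ⟨z, hz, hmax⟩ := isCompact_Icc.exists_isMaxOn (Set.nonempty_Icc.2 zero_le_one)
    (p.continuous.continuousOn (s := Set.Icc (0 : ℝ) 1))
  have hzB : 7 * p.eval z ≤ B := by
    rcases hz.1.eq_or_lt with h0 | h0
    · simpa [← h0] using h z hz
    rcases hz.2.eq_or_lt with h2 | h2
    · rwa [h2]
    have hd := (hmax.isLocalMax (Icc_mem_nhds h0 h2)).deriv_eq_zero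
    rw [Polynomial.deriv] at hd
    simpa [hd] using h z hz
  intro y hy
  have := hmax hy
  simp only [Set.mem_ofPred_eq] at this
  linarith

/-- The coefficients of the power series of `(1 - u) ^ (7 / 2)`. -/
noncomputable def binomCoeff : ℕ → ℝ
  | 0 => 1
  | k + 1 => binomCoeff k * ((k : ℝ) - 7 / 2) / (k + 1)

lemma abs_binomCoeff_le (j : ℕ) : |binomCoeff (j + 4)| * (j + 1) ^ 4 ≤ 7 := by
  have h : |binomCoeff (j + 4)| * ((j + 4) * (j + 3) * (j + 2) * (j + 1)) ≤ 7 := by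
    induction j with
    | zero => norm_num [binomCoeff, abs_div, abs_mul]
    | succ j ih =>
      have hj : (0 : ℝ) ≤ j := j.cast_nonneg
      refine le_trans ?_ ih
      rw [show j + 1 + 4 = (j + 4) + 1 by ring, binomCoeff, abs_div, abs_mul]
      push_cast
      rw [abs_of_nonneg (by linarith : (0 : ℝ) ≤ (j : ℝ) + 4 - 7 / 2),
        abs_of_nonneg (by linarith : (0 : ℝ) ≤ (j : ℝ) + 4 + 1), div_mul_eq_mul_div,
        div_le_iff₀ (by positivity)]
      have h0 := abs_nonneg (binomCoeff (j + 4))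
      have : ((j : ℝ) + 4 - 7 / 2) ≤ (j : ℝ) + 1 := by linarith
      calc _ = |binomCoeff (j + 4)| * ((j : ℝ) + 4 - 7 / 2) *
            ((j + 5) * (j + 4) * (j + 3) * (j + 2)) := by ring
        _ ≤ |binomCoeff (j + 4)| * ((j : ℝ) + 1) * ((j + 5) * (j + 4) * (j + 3) * (j + 2)) := by
          gcongr
        _ = _ := by ring
  refine le_trans ?_ h
  rw [show ((j : ℝ) + 1) ^ 4 = (j + 1) * (j + 1) * (j + 1) * (j + 1) by ring]
  gcongr <;> linarith

open Polynomial in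
/-- The Taylor polynomials of `(1 - u) ^ (7 / 2)`. -/
noncomputable def binomPoly (k : ℕ) : ℝ[X] :=
  ∑ j ∈ Finset.range (k + 1), C (binomCoeff j) * X ^ j

open Polynomial in
lemma binomPoly_ode (k : ℕ) :
    (1 - X) * derivative (binomPoly k) + C (7 / 2) * binomPoly k =
      C ((7 / 2 - k) * binomCoeff k) * X ^ k := by
  induction k with
  | zero => simp [binomPoly, binomCoeff]
  | succ k ih =>
    have hs : binomPoly (k + 1) = binomPoly k + C (binomCoeff (k + 1)) * X ^ (k + 1) := by
      rw [binomPoly, Finset.sum_range_succ]; rfl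
    have hc : C ((7 / 2 - k) * binomCoeff k) = - (C (binomCoeff (k + 1)) * C ((k : ℝ) + 1)) := by
      rw [← C_mul, ← C_neg, binomCoeff]
      congr 1
      field_simp
      ring
    rw [hs, derivative_add, derivative_C_mul, derivative_X_pow]
    rw [hc] at ih
    push_cast [C_add, C_sub, C_mul, C_1] at ih ⊢
    linear_combination ih

open Polynomial in
lemma natDegree_binomPoly_le (k : ℕ) : (binomPoly k).natDegree ≤ k :=
  natDegree_sum_le_of_forall_le _ _ fun j hj =>
    (natDegree_C_mul_X_pow_le _ _).trans (by simpa [Nat.lt_succ_iff] using hj)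

open Polynomial in
/-- Polynomial approximation of `max y 0 ^ 7` with cubic rate. -/
lemma exists_approx_max_pow (N : ℕ) (hN : 1 ≤ N) :
    ∃ R : ℝ[X], R.natDegree ≤ 2 * N + 6 ∧
      ∀ y ∈ Set.Icc (-1 : ℝ) 1, |R.eval y - max y 0 ^ 7| ≤ 1 / (N : ℝ) ^ 3 := by
  obtain ⟨j, rfl⟩ := Nat.exists_eq_add_of_le' hN
  set S := (binomPoly (j + 4)).comp (1 - X ^ 2) with hS
  set B : ℝ := 14 / ((j + 1 : ℕ) : ℝ) ^ 3 with hB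
  have hB0 : 0 < B := by positivity
  have hode : ∀ y : ℝ, 7 * (S - X ^ 7).eval y - y * (derivative (S - X ^ 7)).eval y =
      2 * ((7 / 2 - ((j + 4 : ℕ) : ℝ)) * binomCoeff (j + 4) * (1 - y ^ 2) ^ (j + 4)) := by
    intro y
    have h := congrArg (eval (1 - y ^ 2)) (binomPoly_ode (j + 4))
    simp only [eval_add, eval_mul, eval_sub, eval_one, eval_X, eval_C, eval_pow] at h
    rw [← h]
    simp [hS, derivative_comp]
    ring
  have hbd : ∀ y ∈ Set.Icc (0 : ℝ) 1,
      |7 * (S - X ^ 7).eval y - y * (derivative (S - X ^ 7)).eval y| ≤ B := by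
    intro y ⟨h0, h1⟩
    have hu0 : 0 ≤ 1 - y ^ 2 := by nlinarith
    have hu1 : (1 - y ^ 2) ^ (j + 4) ≤ 1 := pow_le_one₀ hu0 (by nlinarith)
    have hj : (0 : ℝ) ≤ j := j.cast_nonneg
    rw [hode, abs_mul, abs_mul, abs_mul, abs_of_nonneg (pow_nonneg hu0 _), hB, le_div_iff₀
      (by positivity)]
    push_cast
    have hk : |7 / 2 - ((j : ℝ) + 4)| ≤ j + 1 := abs_le.2 ⟨by linarith, by linarith⟩
    have := abs_binomCoeff_le j
    calc |(2 : ℝ)| * (|7 / 2 - ((j : ℝ) + 4)| * |binomCoeff (j + 4)| * (1 - y ^ 2) ^ (j + 4))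
          * (j + 1) ^ 3
        ≤ |(2 : ℝ)| * ((j + 1) * |binomCoeff (j + 4)| * 1) * (j + 1) ^ 3 := by gcongr
      _ = 2 * (|binomCoeff (j + 4)| * (j + 1) ^ 4) := by rw [abs_two]; ring
      _ ≤ 14 := by linarith
  have hS1 : (S - X ^ 7).eval 1 = 0 := by
    simp [hS, binomPoly, eval_finsetSum, Finset.sum_range_succ', binomCoeff]
  have hE : ∀ y ∈ Set.Icc (0 : ℝ) 1, 7 * |S.eval y - y ^ 7| ≤ B := by
    intro y hy
    have hup := eval_le_of_euler_le (p := S - X ^ 7) (B := B) (by rw [hS1]; linarith)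
      (fun z hz => (abs_le.1 (hbd z hz)).2) y hy
    have hlo := eval_le_of_euler_le (p := -(S - X ^ 7)) (B := B)
      (by rw [eval_neg, hS1]; linarith)
      (fun z hz => by
        have := (abs_le.1 (hbd z hz)).1
        rw [derivative_neg, eval_neg, eval_neg]; linarith) y hy
    simp only [eval_neg, eval_sub, eval_pow, eval_X] at hup hlo
    rcases abs_cases (S.eval y - y ^ 7) with ⟨h, _⟩ | ⟨h, _⟩ <;> rw [h] <;> linarith
  refine ⟨C (1 / 2) * (S + X ^ 7), ?_, ?_⟩
  · refine (natDegree_C_mul_le _ _).trans (natDegree_add_le_of_degree_le ?_ ?_)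
    · refine natDegree_comp_le.trans ((Nat.mul_le_mul (natDegree_binomPoly_le _)
        (by compute_degree : (1 - X ^ 2 : ℝ[X]).natDegree ≤ 2)).trans (by omega))
    · rw [natDegree_X_pow]; omega
  · intro y ⟨h0, h1⟩
    have hBe : B = 14 * (1 / ((j + 1 : ℕ) : ℝ) ^ 3) := by rw [hB]; ring
    have hSneg : S.eval (-y) = S.eval y := by simp [hS]
    simp only [eval_mul, eval_C, eval_add, eval_pow, eval_X]
    rcases le_total 0 y with hy | hy
    · have := abs_le.1 (le_of_mul_le_mul_left
        ((hE y ⟨hy, h1⟩).trans_eq (hBe.trans (by ring : _ = 7 * (2 * (1 / ((j + 1 : ℕ) : ℝ) ^ 3)))))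
        (by norm_num))
      rw [max_eq_left hy, abs_le]
      constructor <;> linarith [this.1, this.2]
    · have := abs_le.1 (le_of_mul_le_mul_left
        ((hE (-y) ⟨by linarith, by linarith⟩).trans_eq
          (hBe.trans (by ring : _ = 7 * (2 * (1 / ((j + 1 : ℕ) : ℝ) ^ 3)))))
        (by norm_num))
      rw [hSneg, (by ring : (-y) ^ 7 = - y ^ 7)] at this
      rw [max_eq_right hy, abs_le]
      constructor <;> linarith [this.1, this.2]

lemma hasDerivAt_max_zero_pow (n : ℕ) (y : ℝ) :
    HasDerivAt (fun y : ℝ => max y 0 ^ (n + 2)) ((n + 2) * max y 0 ^ (n + 1)) y := by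
  have hp : HasDerivAt (fun y : ℝ => y ^ (n + 2)) ((n + 2) * y ^ (n + 1)) y := by
    simpa using hasDerivAt_pow (n + 2) y
  rcases lt_trichotomy y 0 with hy | rfl | hy
  · rw [max_eq_right hy.le]
    refine ((hasDerivAt_const y (0 : ℝ)).congr_of_eventuallyEq ?_).congr_deriv (by simp)
    filter_upwards [Iio_mem_nhds hy] with z hz
    have hz' : z ≤ 0 := le_of_lt (Set.mem_Iio.1 hz)
    simp [max_eq_right hz']
  · rw [← hasDerivWithinAt_univ, ← Set.Iic_union_Ici (a := (0 : ℝ))]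
    refine HasDerivWithinAt.union ?_ ?_
    · refine ((hasDerivWithinAt_const (0 : ℝ) _ (0 : ℝ)).congr ?_ ?_).congr_deriv (by simp)
      · intro z hz; simp [max_eq_right (Set.mem_Iic.1 hz)]
      · simp
    · refine (hp.hasDerivWithinAt.congr ?_ ?_).congr_deriv (by simp)
      · intro z hz; simp [max_eq_left (Set.mem_Ici.1 hz)]
      · simp
  · rw [max_eq_left hy.le]
    refine hp.congr_of_eventuallyEq ?_
    filter_upwards [Ioi_mem_nhds hy] with z hz
    have hz' : 0 ≤ z := le_of_lt (Set.mem_Ioi.1 hz)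
    simp [max_eq_left hz']

lemma contDiff_max_zero_pow (k : ℕ) : ContDiff ℝ k (fun y : ℝ => max y 0 ^ (k + 1)) := by
  induction k with
  | zero => exact contDiff_zero.2 (by fun_prop)
  | succ k ih =>
    push_cast
    rw [contDiff_succ_iff_deriv]
    refine ⟨fun y => (hasDerivAt_max_zero_pow k y).differentiableAt, by simp, ?_⟩
    rw [show deriv (fun y : ℝ => max y 0 ^ (k + 1 + 1)) = fun y => ((k : ℝ) + 2) * max y 0 ^ (k + 1)
      from funext fun y => (hasDerivAt_max_zero_pow k y).deriv]
    exact contDiff_const.mul ih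

lemma exists_sub_eq_mul_deriv {F F' : ℝ → ℝ} (hF : ∀ x, HasDerivAt F (F' x) x) (x : ℝ) {h : ℝ}
    (hh : 0 < h) : ∃ ξ ∈ Set.Ioo x (x + h), F (x + h) - F x = h * F' ξ := by
  obtain ⟨ξ, hξ, e⟩ := exists_hasDerivAt_eq_slope F F' (lt_add_of_pos_right x hh)
    (fun y _ => (hF y).continuousAt.continuousWithinAt) (fun y _ => hF y)
  refine ⟨ξ, hξ, ?_⟩
  rw [e, add_sub_cancel_left, mul_div_cancel₀ _ hh.ne']

lemma exists_third_difference_bound {g : ℝ → ℝ} (hg : ContDiff ℝ 3 g) :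
    ∃ K : ℝ, 0 ≤ K ∧ ∀ x h : ℝ, 0 < h → -1 ≤ x → x + 3 * h ≤ 1 →
      |g (x + 3 * h) - 3 * g (x + 2 * h) + 3 * g (x + h) - g x| ≤ K * h ^ 3 := by
  have step : ∀ (n : ℕ) {u : ℝ → ℝ}, ContDiff ℝ (n + 1) u →
      (∀ x, HasDerivAt u (deriv u x) x) ∧ ContDiff ℝ n (deriv u) := by
    intro n u hu
    rw [contDiff_succ_iff_deriv] at hu
    exact ⟨fun x => (hu.1 x).hasDerivAt, hu.2.2⟩
  obtain ⟨d1, c1⟩ := step 2 (by exact_mod_cast hg)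
  obtain ⟨d2, c2⟩ := step 1 (by exact_mod_cast c1)
  obtain ⟨d3, c3⟩ := step 0 (by exact_mod_cast c2)
  set g1 := deriv g
  set g2 := deriv g1
  set g3 := deriv g2
  obtain ⟨K, hK⟩ := isCompact_Icc.exists_bound_of_continuousOn
    (c3.continuous.continuousOn (s := Set.Icc (-1 : ℝ) 1))
  have hK0 : 0 ≤ K := (norm_nonneg _).trans (hK 0 (by simp))
  refine ⟨K, hK0, fun x h hh hx hx1 => ?_⟩
  have shift : ∀ {u u' : ℝ → ℝ}, (∀ x, HasDerivAt u (u' x) x) → ∀ c x : ℝ,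
      HasDerivAt (fun x => u (x + c)) (u' (x + c)) x := fun hu c x =>
    (hu (x + c)).comp_add_const x c
  obtain ⟨ξ, hξ, e1⟩ := exists_sub_eq_mul_deriv
    (F := fun y => g (y + 2 * h) - 2 * g (y + h) + g y)
    (F' := fun y => g1 (y + 2 * h) - 2 * g1 (y + h) + g1 y)
    (fun y => ((shift d1 _ y).sub ((shift d1 _ y).const_mul 2)).add (d1 y)) x hh
  obtain ⟨η, hη, e2⟩ := exists_sub_eq_mul_deriv
    (F := fun y => g1 (y + h) - g1 y) (F' := fun y => g2 (y + h) - g2 y)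
    (fun y => (shift d2 _ y).sub (d2 y)) ξ hh
  obtain ⟨ζ, hζ, e3⟩ := exists_sub_eq_mul_deriv d3 η hh
  have hb := hK ζ ⟨by linarith [hξ.1, hη.1, hζ.1], by linarith [hξ.2, hη.2, hζ.2]⟩
  have e : g (x + 3 * h) - 3 * g (x + 2 * h) + 3 * g (x + h) - g x = h ^ 3 * g3 ζ := by
    rw [show x + h + 2 * h = x + 3 * h by ring, show x + h + h = x + 2 * h by ring] at e1
    rw [show ξ + h + h = ξ + 2 * h by ring] at e2
    linear_combination e1 + h * e2 + h ^ 2 * e3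
  rw [e, abs_mul, abs_of_pos (by positivity : 0 < h ^ 3), mul_comm]
  gcongr
  exact hb

lemma sum_third_difference (g : ℝ → ℝ) (x h : ℝ) :
    ∑ i ∈ Finset.range (3 + 1), (-1 : ℝ) ^ (3 - i) * ((3 : ℕ).choose i : ℝ) * g (x + (i : ℝ) * h) =
      g (x + 3 * h) - 3 * g (x + 2 * h) + 3 * g (x + h) - g x := by
  simp [Finset.sum_range_succ, Nat.choose]
  ring

lemma omegaK_three_le {f g : ℝ → ℝ} {β K t : ℝ} (hβ : 0 ≤ β) (hK : 0 ≤ K) (ht : 0 ≤ t)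
    (hfg : ∀ x ∈ Set.Icc (-1 : ℝ) 1, |f x - g x| ≤ β)
    (hg : ∀ x h : ℝ, 0 < h → -1 ≤ x → x + 3 * h ≤ 1 →
      |g (x + 3 * h) - 3 * g (x + 2 * h) + 3 * g (x + h) - g x| ≤ K * h ^ 3) :
    omegaK f 3 t (-1) 1 ≤ 8 * β + K * t ^ 3 := by
  refine Real.sSup_le ?_ (by positivity)
  rintro v ⟨h, x, hh, hht, hx, hx1, rfl⟩
  rw [sum_third_difference]
  push_cast at hx1
  have hgx := (hg x h hh hx hx1).trans (by gcongr : _ ≤ K * t ^ 3)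
  have h0 := abs_le.1 (hfg x ⟨hx, by linarith⟩)
  have h1 := abs_le.1 (hfg (x + h) ⟨by linarith, by linarith⟩)
  have h2 := abs_le.1 (hfg (x + 2 * h) ⟨by linarith, by linarith⟩)
  have h3 := abs_le.1 (hfg (x + 3 * h) ⟨by linarith, by linarith⟩)
  rw [abs_le] at hgx ⊢
  constructor <;> linarith [h0.1, h0.2, h1.1, h1.2, h2.1, h2.2, h3.1, h3.2, hgx.1, hgx.2]

lemma omegaK_three_pos {f : ℝ → ℝ} {t : ℝ} (ht : 0 < t)
    (hf : ContinuousOn f (Set.Icc (-1 : ℝ) 1))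
    (hzero : ∀ x ∈ Set.Icc (-1 : ℝ) (-1/2 : ℝ), f x = 0)
    (hpos : ∀ x ∈ Set.Ioo (-1/2 : ℝ) (-1/4), 0 < f x) :
    0 < omegaK f 3 t (-1) 1 := by
  obtain ⟨B, hB⟩ := isCompact_Icc.exists_bound_of_continuousOn hf
  set h := min t (1 / 8) with hh
  have h0 : 0 < h := lt_min ht (by norm_num)
  have h8 : h ≤ 1 / 8 := min_le_right _ _
  have hp := hpos (-1/2 + h) ⟨by linarith, by linarith⟩
  refine hp.trans_le (le_csSup ?_ ⟨h, -1/2 - 2 * h, h0, min_le_left _ _, by linarith,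
    by push_cast; linarith, ?_⟩)
  · refine ⟨8 * B, ?_⟩
    rintro v ⟨h, x, hh, hht, hx, hx1, rfl⟩
    rw [sum_third_difference]
    push_cast at hx1
    have h0 := abs_le.1 (hB x ⟨hx, by linarith⟩)
    have h1 := abs_le.1 (hB (x + h) ⟨by linarith, by linarith⟩)
    have h2 := abs_le.1 (hB (x + 2 * h) ⟨by linarith, by linarith⟩)
    have h3 := abs_le.1 (hB (x + 3 * h) ⟨by linarith, by linarith⟩)
    rw [abs_le]
    constructor <;> linarith [h0.1, h0.2, h1.1, h1.2, h2.1, h2.2, h3.1, h3.2]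
  · rw [sum_third_difference, hzero (-1/2 - 2 * h) ⟨by linarith, by linarith⟩,
      hzero (-1/2 - 2 * h + h) ⟨by linarith, by linarith⟩,
      hzero (-1/2 - 2 * h + 2 * h) ⟨by linarith, by linarith⟩,
      show -1/2 - 2 * h + 3 * h = -1/2 + h by ring]
    simp [abs_of_pos hp]

lemma rho_pos {n : ℕ} (hn : 1 ≤ n) (x : ℝ) : 0 < rho n x := by
  have : (0 : ℝ) < n := by exact_mod_cast hn
  unfold rho
  positivity

lemma rho_le {n : ℕ} (hn : 1 ≤ n) (x : ℝ) : rho n x ≤ 2 / n := by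
  have h1 : (1 : ℝ) ≤ n := by exact_mod_cast hn
  have hs : Real.sqrt (1 - x ^ 2) ≤ 1 := Real.sqrt_le_one.2 (by nlinarith [sq_nonneg x])
  unfold rho
  have : 1 / (n : ℝ) ^ 2 ≤ 1 / n := by
    apply one_div_le_one_div_of_le (by positivity); nlinarith
  have : Real.sqrt (1 - x ^ 2) / n ≤ 1 / n := by gcongr
  calc _ ≤ 1 / (n : ℝ) + 1 / n := by linarith
    _ = _ := by ring

/-- A `C³` bump that vanishes on `(-∞, -1/2]`. -/
noncomputable def cutoff (x : ℝ) : ℝ := max ((x + 1 / 2) / 2) 0 ^ 7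

lemma cutoff_nonneg (x : ℝ) : 0 ≤ cutoff x := by unfold cutoff; positivity

lemma cutoff_le_one {x : ℝ} (hx : x ≤ 1) : cutoff x ≤ 1 :=
  pow_le_one₀ (le_max_right _ _) (max_le (by linarith) zero_le_one)

lemma cutoff_eq_zero {x : ℝ} (hx : x ≤ -1 / 2) : cutoff x = 0 := by
  rw [cutoff, max_eq_right (by linarith)]; norm_num

lemma cutoff_pos {x : ℝ} (hx : -1 / 2 < x) : 0 < cutoff x :=
  pow_pos (lt_max_of_lt_left (by linarith)) 7

lemma le_cutoff {x : ℝ} (hx : 0 ≤ x) : 1 / 4 ^ 7 ≤ cutoff x := by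
  have : (1 / 4 : ℝ) ≤ max ((x + 1 / 2) / 2) 0 := le_max_of_le_left (by linarith)
  calc (1 / 4 ^ 7 : ℝ) = (1 / 4) ^ 7 := by norm_num
    _ ≤ _ := by unfold cutoff; gcongr

/-- The quadratic `s (x - l)² + b (x - l)`. -/
noncomputable def quad (l s b x : ℝ) : ℝ := s * (x - l) ^ 2 + b * (x - l)

/-- The counterexample function: the positive part of a quadratic times the bump. -/
noncomputable def witness (l s b x : ℝ) : ℝ := cutoff x * max (quad l s b x) 0

lemma witness_nonneg (l s b x : ℝ) : 0 ≤ witness l s b x :=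
  mul_nonneg (cutoff_nonneg x) (le_max_right _ _)

lemma continuous_cutoff : Continuous cutoff := by unfold cutoff; fun_prop

lemma continuous_witness (l s b : ℝ) : Continuous (witness l s b) := by
  have := continuous_cutoff
  unfold witness quad
  fun_prop

lemma witness_self (l s b : ℝ) : witness l s b l = 0 := by simp [witness, quad]

lemma contDiff_cutoff : ContDiff ℝ 3 cutoff := by
  have h : ContDiff ℝ 3 (fun y : ℝ => max y 0 ^ 7) :=
    (contDiff_max_zero_pow 6).of_le (by norm_cast)
  exact h.comp (by fun_prop : ContDiff ℝ 3 fun x : ℝ => (x + 1 / 2) / 2)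

lemma exists_third_difference_bound_quad (l : ℝ) :
    ∃ K : ℝ, 0 ≤ K ∧ ∀ s b : ℝ, |s| ≤ 1 → |b| ≤ 1 →
      ∀ x h : ℝ, 0 < h → -1 ≤ x → x + 3 * h ≤ 1 →
        |cutoff (x + 3 * h) * quad l s b (x + 3 * h)
          - 3 * (cutoff (x + 2 * h) * quad l s b (x + 2 * h))
          + 3 * (cutoff (x + h) * quad l s b (x + h)) - cutoff x * quad l s b x| ≤ K * h ^ 3 := by
  have hc := contDiff_cutoff
  obtain ⟨K₁, h₁, H₁⟩ := exists_third_difference_bound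
    (by fun_prop : ContDiff ℝ 3 fun x => cutoff x * (x - l) ^ 2)
  obtain ⟨K₂, h₂, H₂⟩ := exists_third_difference_bound
    (by fun_prop : ContDiff ℝ 3 fun x => cutoff x * (x - l))
  refine ⟨K₁ + K₂, by positivity, fun s b hs hb x h hh hx hx1 => ?_⟩
  have e₁ := H₁ x h hh hx hx1
  have e₂ := H₂ x h hh hx hx1
  set d₁ := cutoff (x + 3 * h) * (x + 3 * h - l) ^ 2 - 3 * (cutoff (x + 2 * h) *
    (x + 2 * h - l) ^ 2) + 3 * (cutoff (x + h) * (x + h - l) ^ 2) - cutoff x * (x - l) ^ 2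
  set d₂ := cutoff (x + 3 * h) * (x + 3 * h - l) - 3 * (cutoff (x + 2 * h) *
    (x + 2 * h - l)) + 3 * (cutoff (x + h) * (x + h - l)) - cutoff x * (x - l)
  calc _ = |s * d₁ + b * d₂| := by congr 1; simp only [quad, d₁, d₂]; ring
    _ ≤ |s| * |d₁| + |b| * |d₂| := by rw [← abs_mul, ← abs_mul]; exact abs_add_le _ _
    _ ≤ 1 * |d₁| + 1 * |d₂| := by gcongr
    _ ≤ _ := by linarith

open Polynomial in
/-- A polynomial with a local minimum at `l` that approximates the witness well produces a
polynomial that is uniformly small and has a large derivative at `l`. -/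
lemma exists_small_polynomial_of_approx {l : ℝ} (hl : l ∈ Set.Icc (0 : ℝ) 1) :
    ∃ K : ℝ, 0 ≤ K ∧ ∀ N : ℕ, 64 ≤ N → ∀ s b M : ℝ, |s| ≤ 1 → |b| ≤ 1 → 0 ≤ M →
      (∀ x ∈ Set.Icc (-1 : ℝ) 1, -quad l s b x ≤ 1 / (N : ℝ) ^ 3) →
      ∀ P : ℝ[X], P.natDegree ≤ 2 * N + 8 →
        (∃ ε : ℝ, 0 < ε ∧ ∀ x ∈ Set.Ioo (l - ε) (l + ε), 0 ≤ P.eval x) →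
        P.eval l = witness l s b l →
        (∀ x ∈ Set.Icc (-1 : ℝ) 1, |witness l s b x - P.eval x| ≤
          M * omegaK (witness l s b) 3 (rho (2 * N + 8) x) (-1) 1) →
        ∃ D : ℝ[X], D.natDegree ≤ 2 * N + 8 ∧
          (∀ x ∈ Set.Icc (-1 : ℝ) 1, |D.eval x| ≤ (M * (8 + K) + 7) / (N : ℝ) ^ 3) ∧
          |b| / 4 ^ 8 ≤ |(derivative D).eval l| := by
  obtain ⟨K, hK0, hK⟩ := exists_third_difference_bound_quad l
  refine ⟨K, hK0, fun N hN s b M hs hb hM hq P hP hpos hPl happ => ?_⟩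
  have hN64 : (64 : ℝ) ≤ N := by exact_mod_cast hN
  have hN0 : (0 : ℝ) < N := by linarith
  obtain ⟨R, hR, hRa⟩ := exists_approx_max_pow N (by omega)
  set S := R.comp (C (1 / 2) * (X + C (1 / 2))) with hS
  have hSe : ∀ x, S.eval x = R.eval ((x + 1 / 2) / 2) := by
    intro x; simp only [hS, eval_comp, eval_mul, eval_C, eval_add, eval_X]; congr 1; ring
  have hSa : ∀ x ∈ Set.Icc (-1 : ℝ) 1, |S.eval x - cutoff x| ≤ 1 / (N : ℝ) ^ 3 := fun x hx => by
    rw [hSe]; exact hRa _ ⟨by linarith [hx.1], by linarith [hx.2]⟩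
  have hφ : ∀ x ∈ Set.Icc (-1 : ℝ) 1, |witness l s b x - cutoff x * quad l s b x| ≤
      1 / (N : ℝ) ^ 3 := by
    intro x hx
    have hc0 := cutoff_nonneg x
    have hc1 := cutoff_le_one hx.2
    have hm : |max (quad l s b x) 0 - quad l s b x| ≤ 1 / (N : ℝ) ^ 3 := by
      have := hq x hx
      have hN3 : 0 ≤ 1 / (N : ℝ) ^ 3 := by positivity
      rcases le_total 0 (quad l s b x) with h | h
      · rwa [max_eq_left h, sub_self, abs_zero]
      · rw [max_eq_right h, zero_sub, abs_neg, abs_of_nonpos h]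
        exact this
    rw [witness, ← mul_sub, abs_mul, abs_of_nonneg hc0]
    calc _ ≤ 1 * |max (quad l s b x) 0 - quad l s b x| := by gcongr
      _ ≤ _ := by rwa [one_mul]
  refine ⟨P - S * (C s * (X - C l) ^ 2 + C b * (X - C l)), ?_, fun x hx => ?_, ?_⟩
  · refine (natDegree_sub_le_of_le hP (natDegree_mul_le_of_le (m := 2 * N + 6) (n := 2) ?_ ?_)).trans
      (max_self _).le
    · exact natDegree_comp_le.trans ((Nat.mul_le_mul hR (by compute_degree)).trans (mul_one _).le)
    · compute_degree
  · have hn : 1 ≤ 2 * N + 8 := by omega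
    have hρ : rho (2 * N + 8) x ≤ 1 / N := by
      refine (rho_le hn x).trans ?_
      rw [div_le_div_iff₀ (by positivity) hN0]
      push_cast
      linarith
    have hω : omegaK (witness l s b) 3 (rho (2 * N + 8) x) (-1) 1 ≤ (8 + K) / (N : ℝ) ^ 3 := by
      refine (omegaK_three_le (by positivity) hK0 (rho_pos hn x).le hφ (hK s b hs hb)).trans ?_
      have := (rho_pos hn x).le
      calc _ ≤ 8 * (1 / (N : ℝ) ^ 3) + K * (1 / N) ^ 3 := by gcongr
        _ = _ := by ring
    have hquad : |quad l s b x| ≤ 6 := by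
      have hxl : |x - l| ≤ 2 := abs_le.2 ⟨by linarith [hx.1, hl.2], by linarith [hx.2, hl.1]⟩
      calc |quad l s b x| ≤ |s| * |x - l| ^ 2 + |b| * |x - l| := by
            rw [← abs_pow, ← abs_mul, ← abs_mul]; exact abs_add_le _ _
        _ ≤ 1 * 2 ^ 2 + 1 * 2 := by gcongr
        _ = 6 := by norm_num
    have e₁ := (happ x hx).trans (mul_le_mul_of_nonneg_left hω hM)
    have e₂ := hφ x hx
    have e₃ : |(S.eval x - cutoff x) * quad l s b x| ≤ 1 / (N : ℝ) ^ 3 * 6 := by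
      rw [abs_mul]
      gcongr
      exact hSa x hx
    have e : (P - S * (C s * (X - C l) ^ 2 + C b * (X - C l))).eval x =
        -(witness l s b x - P.eval x) + (witness l s b x - cutoff x * quad l s b x)
          - (S.eval x - cutoff x) * quad l s b x := by
      simp [quad]; ring
    rw [e]
    calc _ ≤ |witness l s b x - P.eval x| + |witness l s b x - cutoff x * quad l s b x|
          + |(S.eval x - cutoff x) * quad l s b x| := by
          refine (abs_sub _ _).trans ?_
          gcongr
          refine (abs_add_le _ _).trans ?_
          rw [abs_neg]
      _ ≤ M * ((8 + K) / (N : ℝ) ^ 3) + 1 / (N : ℝ) ^ 3 + 1 / (N : ℝ) ^ 3 * 6 := by gcongr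
      _ = _ := by ring
  · have hPd : (derivative P).eval l = 0 := by
      obtain ⟨ε, hε, h⟩ := hpos
      have hm : IsLocalMin (fun x => P.eval x) l := by
        filter_upwards [Ioo_mem_nhds (by linarith : l - ε < l) (by linarith : l < l + ε)] with x hx
        rw [hPl, witness_self]
        exact h x hx
      simpa using hm.deriv_eq_zero
    have hSl : 1 / 4 ^ 8 ≤ S.eval l := by
      have h1 := (abs_le.1 (hSa l ⟨by linarith [hl.1], hl.2⟩)).1
      have h2 := le_cutoff hl.1
      have h3 : 1 / (N : ℝ) ^ 3 ≤ 1 / 64 ^ 3 := by gcongr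
      have h4 : (1 : ℝ) / 4 ^ 8 + 1 / 64 ^ 3 ≤ 1 / 4 ^ 7 := by norm_num
      linarith
    have : (derivative (P - S * (C s * (X - C l) ^ 2 + C b * (X - C l)))).eval l
        = - (b * S.eval l) := by
      simp [hPd, derivative_pow]; ring
    rw [this, abs_neg, abs_mul, abs_of_nonneg (le_trans (by norm_num) hSl), div_eq_mul_one_div]
    gcongr

open Polynomial in
/-- Suitable parameters of the quadratic factor: a small negative part, but a derivative at `l`
that small polynomials of degree `2 * N + 8` cannot have. -/
lemma exists_quad_params {l : ℝ} (hl : l ∈ Set.Icc (0 : ℝ) 1) :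
    ∃ κ : ℝ, 0 < κ ∧ ∀ N : ℕ, 64 ≤ N → ∃ s b : ℝ, |s| ≤ 1 ∧ |b| ≤ 1 ∧
      (∀ x ∈ Set.Icc (-1 : ℝ) 1, -quad l s b x ≤ 1 / (N : ℝ) ^ 3) ∧
      (∀ x ∈ Set.Ioo (-1/2 : ℝ) (-1/4), 0 < quad l s b x) ∧
      ∀ (D : ℝ[X]) (ε : ℝ), 0 < ε → D.natDegree ≤ 2 * N + 8 →
        (∀ x ∈ Set.Icc (-1 : ℝ) 1, |D.eval x| ≤ ε / (N : ℝ) ^ 3) →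
        |b| / 4 ^ 8 ≤ |(derivative D).eval l| → √(N : ℝ) ≤ κ * ε := by
  have hsqrt : ∀ N : ℕ, 64 ≤ N → √(N : ℝ) ≤ N := fun N hN => by
    have hN64 : (64 : ℝ) ≤ N := by exact_mod_cast hN
    exact Real.sqrt_le_iff.2 ⟨by linarith, by nlinarith⟩
  have hdeg : ∀ N : ℕ, 64 ≤ N → ((2 * N + 8 : ℕ) : ℝ) ≤ 10 * N := fun N hN => by
    have hN64 : (64 : ℝ) ≤ N := by exact_mod_cast hN
    push_cast
    linarith
  rcases hl.2.eq_or_lt with rfl | hl1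
  · refine ⟨100 * 4 ^ 8, by norm_num, fun N hN => ⟨0, -1, by simp, by simp, ?_, ?_, ?_⟩⟩
    · intro x hx
      have : 0 ≤ 1 / (N : ℝ) ^ 3 := by positivity
      simp only [quad]
      linarith [hx.2]
    · intro x hx
      simp only [quad]
      linarith [hx.2]
    · intro D ε hε hD hb hd
      have hN0 : (0 : ℝ) < N := by exact_mod_cast (by omega : 0 < N)
      have h := hd.trans (abs_derivative_eval_one_le hD (by positivity) hb)
      have h' : ((2 * N + 8 : ℕ) : ℝ) ^ 2 * (ε / (N : ℝ) ^ 3) ≤ 100 * ε / N := by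
        calc _ ≤ (10 * (N : ℝ)) ^ 2 * (ε / (N : ℝ) ^ 3) := by gcongr; exact hdeg N hN
          _ = _ := by field_simp; norm_num
      have h2 := h.trans h'
      rw [le_div_iff₀ hN0] at h2
      norm_num at h2
      have := hsqrt N hN
      norm_num
      linarith
  · have hl0 : 0 < 1 - l := by linarith
    refine ⟨20 * 4 ^ 8 / (1 - l), by positivity, fun N hN => ?_⟩
    have hN64 : (64 : ℝ) ≤ N := by exact_mod_cast hN
    have hN0 : (0 : ℝ) < N := by linarith
    have hsN := hsqrt N hN
    set b : ℝ := √(N : ℝ) / (N : ℝ) ^ 2 with hb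
    have hb0 : 0 ≤ b := by positivity
    have hb2 : b ^ 2 = 1 / (N : ℝ) ^ 3 := by
      rw [hb, div_pow, Real.sq_sqrt hN0.le]; field_simp
    have hb4 : b ≤ 1 / 4 := by
      rw [hb, div_le_iff₀ (by positivity)]; nlinarith
    refine ⟨1, b, by simp, by rw [abs_of_nonneg hb0]; linarith, ?_, ?_, ?_⟩
    · intro x hx
      rw [← hb2, quad]
      nlinarith [sq_nonneg (x - l + b / 2), sq_nonneg b]
    · intro x hx
      rw [quad]
      nlinarith [hx.2, hl.1, mul_pos (by linarith [hx.2, hl.1] : 0 < l - x)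
        (by linarith [hx.2, hl.1] : 0 < l - x - b)]
    · intro D ε hε hD hDb hd
      have h := hd.trans (abs_derivative_eval_le hD (by positivity) ⟨hl.1, hl1⟩ hDb)
      have h' : 2 * ((2 * N + 8 : ℕ) : ℝ) * (ε / (N : ℝ) ^ 3) / (1 - l) ≤
          20 * ε / (1 - l) / (N : ℝ) ^ 2 := by
        calc _ ≤ 2 * (10 * (N : ℝ)) * (ε / (N : ℝ) ^ 3) / (1 - l) := by gcongr; exact hdeg N hN
          _ = _ := by field_simp; norm_num
      have h2 := h.trans h'
      rw [abs_of_nonneg hb0, hb, div_div, mul_comm, ← div_div,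
        div_le_div_iff_of_pos_right (by positivity), div_le_iff₀ (by positivity)] at h2
      calc _ ≤ _ := h2
        _ = _ := by ring

/-- Copositive approximation with interpolatory constraints, negative result for `f ∈ C`:
for any `A > 1`, `λ ∈ [0,1]`, `n₀ ∈ ℕ` and any positive null sequence `(α_n)`, there are
`n ≥ n₀` and a continuous nonnegative `f = f_n` on `[-1,1]` vanishing on `[-1,-1/2]` such
that any polynomial of degree ≤ n, nonnegative in some neighborhood of `λ`, with
`P_n(λ) = f(λ)`, satisfies `sup_{x} |f(x)-P_n(x)| / ω₃(f, ρ_n(x)) > A α_n √n`. -/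
theorem statement9 (A : ℝ) (hA : 1 < A) (lam : ℝ) (hlam : lam ∈ Set.Icc (0 : ℝ) 1)
    (n₀ : ℕ) (hn₀ : 1 ≤ n₀) (a : ℕ → ℝ) (ha : ∀ n, 0 < a n)
    (hlim : Filter.Tendsto a Filter.atTop (nhds 0)) :
    ∃ n : ℕ, n₀ ≤ n ∧ ∃ f : ℝ → ℝ,
      ContinuousOn f (Set.Icc (-1 : ℝ) 1) ∧
      (∀ x ∈ Set.Icc (-1 : ℝ) 1, 0 ≤ f x) ∧
      (∀ x ∈ Set.Icc (-1 : ℝ) (-1/2 : ℝ), f x = 0) ∧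
      ∀ P : Polynomial ℝ, P.natDegree ≤ n →
        (∃ ε : ℝ, 0 < ε ∧ ∀ x ∈ Set.Ioo (lam - ε) (lam + ε), 0 ≤ P.eval x) →
        P.eval lam = f lam →
        ∃ x ∈ Set.Icc (-1 : ℝ) 1,
          A * a n * Real.sqrt n < |f x - P.eval x| / omegaK f 3 (rho n x) (-1) 1 := by
  obtain ⟨K, hK0, hK⟩ := exists_small_polynomial_of_approx hlam
  obtain ⟨κ, hκ0, hκ⟩ := exists_quad_params hlam
  set δ : ℝ := 1 / (8 * κ * A * (8 + K)) with hδ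
  have hA0 : 0 < A := by linarith
  have hδ0 : 0 < δ := by positivity
  obtain ⟨n₁, hn₁⟩ := Filter.eventually_atTop.1 (hlim.eventually (gt_mem_nhds hδ0))
  obtain ⟨n₂, hn₂⟩ := exists_nat_gt ((14 * κ) ^ 2)
  set N := n₀ + n₁ + n₂ + 64 with hN
  have hN64 : 64 ≤ N := by omega
  have hn : 1 ≤ 2 * N + 8 := by omega
  obtain ⟨s, b, hs, hb, hq, hqpos, hD⟩ := hκ N hN64
  have hcont := (continuous_witness lam s b).continuousOn (s := Set.Icc (-1 : ℝ) 1)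
  have hzero : ∀ x ∈ Set.Icc (-1 : ℝ) (-1/2 : ℝ), witness lam s b x = 0 := fun x hx => by
    rw [witness, cutoff_eq_zero hx.2, zero_mul]
  refine ⟨2 * N + 8, by omega, witness lam s b, hcont, fun x _ => witness_nonneg _ _ _ x, hzero,
    fun P hP hpos hPl => ?_⟩
  by_contra! hcon
  set M := A * a (2 * N + 8) * √((2 * N + 8 : ℕ) : ℝ) with hM
  have ha0 := ha (2 * N + 8)
  have hM0 : 0 ≤ M := by positivity
  obtain ⟨D, hDdeg, hDb, hDd⟩ := hK N hN64 s b M hs hb hM0 hq P hP hpos hPl fun x hx => by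
    have hω : 0 < omegaK (witness lam s b) 3 (rho (2 * N + 8) x) (-1) 1 :=
      omegaK_three_pos (rho_pos hn x) hcont hzero fun y hy =>
        mul_pos (cutoff_pos hy.1) (lt_max_of_lt_left (hqpos y hy))
    exact (div_le_iff₀ hω).1 (hcon x hx)
  have hfin := hD D _ (by positivity) hDdeg hDb hDd
  have haδ : a (2 * N + 8) < δ := hn₁ _ (by omega)
  have hNκ : 14 * κ < √(N : ℝ) := by
    refine Real.lt_sqrt_of_sq_lt (hn₂.trans_le ?_)
    exact_mod_cast (by omega : n₂ ≤ N)
  have hroot : √((2 * N + 8 : ℕ) : ℝ) ≤ 4 * √(N : ℝ) := by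
    refine Real.sqrt_le_iff.2 ⟨by positivity, ?_⟩
    rw [mul_pow, Real.sq_sqrt N.cast_nonneg]
    exact_mod_cast (by omega : 2 * N + 8 ≤ 4 ^ 2 * N)
  have hMle : κ * (M * (8 + K)) ≤ √(N : ℝ) / 2 := by
    calc κ * (M * (8 + K)) ≤ κ * (A * δ * (4 * √(N : ℝ)) * (8 + K)) := by rw [hM]; gcongr
      _ = √(N : ℝ) / 2 := by rw [hδ]; field_simp; norm_num
  linarith
end

section
/- Let r ≥ 2 be an EVEN integer. Then for any n ≥ r, any A > 0 and any λ ∈ [0,1], there exists f ∈ C^r which is nonnegative on I and identically 0 on [-1, -1/2], such that for every polynomial P_n of degree ≤ n which is nonnegative on (λ - 1/n, λ) and satisfies P_n^(i)(λ) = f^(i)(λ) for all 0 ≤ i ≤ r, one has ‖f - P_n‖ > A ‖f^(r)‖. Hence positive polynomial approximation with Hermite interpolation of full order r at λ is impossible for even r. -/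
/-- The sup norm of `g` on `[a,b]`. -/
noncomputable def supNorm (g : ℝ → ℝ) (a b : ℝ) : ℝ :=
  sSup ((fun x => |g x|) '' Set.Icc a b)

open Filter Topology Polynomial

theorem supNorm_le_of_forall_abs_le {g : ℝ → ℝ} {a b B : ℝ} (hab : a ≤ b)
    (h : ∀ x ∈ Set.Icc a b, |g x| ≤ B) : supNorm g a b ≤ B := by
  refine csSup_le ((Set.nonempty_Icc.2 hab).image _) ?_
  rintro _ ⟨x, hx, rfl⟩
  exact h x hx

theorem abs_le_supNorm {g : ℝ → ℝ} {a b x : ℝ} (hg : ContinuousOn g (Set.Icc a b))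
    (hx : x ∈ Set.Icc a b) : |g x| ≤ supNorm g a b :=
  le_csSup (isCompact_Icc.image_of_continuousOn hg.abs).bddAbove ⟨x, hx, rfl⟩

/-- Polynomials of bounded degree that are uniformly bounded on `[-1, 1]` have a subsequence
along which every linear functional converges. -/
theorem exists_subseq_tendsto_of_bounded {n : ℕ} {B : ℝ} (P : ℕ → ℝ[X])
    (hdeg : ∀ m, (P m).natDegree ≤ n)
    (hB : ∀ m, ∀ x ∈ Set.Icc (-1 : ℝ) 1, |(P m).eval x| ≤ B) :
    ∃ (Q : ℝ[X]) (φ : ℕ → ℕ), StrictMono φ ∧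
      ∀ L : ℝ[X] →ₗ[ℝ] ℝ, Tendsto (fun m => L (P (φ m))) atTop (𝓝 (L Q)) := by
  let v : Fin (n + 1) → ℝ := fun i => (i : ℝ) / (n + 1)
  have hpos : (0 : ℝ) < n + 1 := by positivity
  have hv : Set.InjOn v (Finset.univ : Finset (Fin (n + 1))) := by
    intro i _ j _ hij
    have : (i : ℝ) = j := (div_left_inj' hpos.ne').1 hij
    exact Fin.ext (by exact_mod_cast this)
  have hvI : ∀ i, v i ∈ Set.Icc (-1 : ℝ) 1 := by
    intro i
    have h0 : (0 : ℝ) ≤ v i := by positivity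
    have hi : (i : ℝ) ≤ n + 1 := by exact_mod_cast i.2.le
    exact ⟨by linarith, (div_le_one hpos).2 hi⟩
  obtain ⟨y, -, φ, hφ, hy⟩ := tendsto_subseq_of_bounded
    (Metric.isBounded_closedBall (x := (0 : Fin (n + 1) → ℝ)) (r := B))
    (x := fun m i => (P m).eval (v i)) (fun m => by
      rw [mem_closedBall_zero_iff]
      exact (pi_norm_le_iff_of_nonempty _).2 fun i => hB m _ (hvI i))
  refine ⟨Lagrange.interpolate Finset.univ v y, φ, hφ, fun L => ?_⟩
  have hP : ∀ m, P m = Lagrange.interpolate Finset.univ v fun i => (P m).eval (v i) := by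
    intro m
    refine Lagrange.eq_interpolate hv ?_
    rw [Finset.card_univ, Fintype.card_fin]
    exact degree_le_natDegree.trans_lt (by exact_mod_cast Nat.lt_succ_of_le (hdeg m))
  have hcont : Continuous (L.comp (Lagrange.interpolate Finset.univ v)) :=
    LinearMap.continuous_of_finiteDimensional _
  refine ((hcont.tendsto y).comp hy).congr fun m => ?_
  simp only [Function.comp_apply, LinearMap.comp_apply]
  rw [← hP (φ m)]

/-- A polynomial that is nonnegative to the left of `lam` and vanishes there to even order `r` has
a nonnegative `r`-th derivative at `lam`. -/
theorem eval_iterate_derivative_nonneg {Q : ℝ[X]} {r : ℕ} (hr : Even r) {lam d : ℝ} (hd : 0 < d)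
    (hQ : ∀ x ∈ Set.Ioo (lam - d) lam, 0 ≤ Q.eval x)
    (h0 : ∀ i < r, (derivative^[i] Q).eval lam = 0) :
    0 ≤ (derivative^[r] Q).eval lam := by
  have hfac : ∀ i, (derivative^[i] Q).eval lam = i.factorial * (taylor lam Q).coeff i := by
    intro i
    rw [← factorial_smul_hasseDeriv, taylor_coeff]
    simp
  have hdvd : X ^ r ∣ taylor lam Q := X_pow_dvd_iff.2 fun i hi => by
    have := h0 i hi
    rw [hfac] at this
    exact (mul_eq_zero.1 this).resolve_left (by positivity)
  obtain ⟨R, hR⟩ := hdvd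
  have hcoeff : (taylor lam Q).coeff r = R.eval 0 := by
    rw [hR, coeff_X_pow_mul', if_pos le_rfl, Nat.sub_self, coeff_zero_eq_eval_zero]
  rw [hfac, hcoeff]
  refine mul_nonneg (by positivity) ?_
  have hlim : Tendsto (fun t => R.eval t) (𝓝[<] 0) (𝓝 (R.eval 0)) :=
    R.continuous.continuousWithinAt
  refine ge_of_tendsto hlim ?_
  filter_upwards [Ioo_mem_nhdsLT (neg_lt_zero.2 hd)] with t ht
  have h1 : Q.eval (t + lam) = t ^ r * R.eval t := by
    rw [← taylor_eval, hR]; simp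
  have h2 := hQ (t + lam) ⟨by linarith [ht.1], by linarith [ht.2]⟩
  rw [h1] at h2
  exact nonneg_of_mul_nonneg_right h2 (hr.pow_pos ht.2.ne)

/-- A small rapid oscillation whose derivative of order `2 * k` at `lam` is `-1`. -/
noncomputable def cosOscillation (k : ℕ) (lam a x : ℝ) : ℝ :=
  (a ^ (2 * k))⁻¹ * (1 + -(-1) ^ k * Real.cos (a * (-lam + x)))

theorem contDiff_cosOscillation (k : ℕ) (lam a : ℝ) {N : ℕ∞} :
    ContDiff ℝ N (cosOscillation k lam a) := by
  unfold cosOscillation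
  fun_prop

theorem cosOscillation_nonneg (k : ℕ) (lam a x : ℝ) : 0 ≤ cosOscillation k lam a x := by
  refine mul_nonneg (inv_nonneg.2 ((even_two_mul k).pow_nonneg a)) ?_
  have h : |(-(-1) ^ k : ℝ) * Real.cos (a * (-lam + x))| ≤ 1 := by
    rw [abs_mul]; simpa using Real.abs_cos_le_one (a * (-lam + x))
  linarith [neg_le_of_abs_le h]

theorem iteratedDeriv_cosOscillation (k : ℕ) (lam a x : ℝ) {i : ℕ} (hi : 0 < i) :
    iteratedDeriv i (cosOscillation k lam a) x =
      (a ^ (2 * k))⁻¹ * (-(-1) ^ k * (a ^ i * iteratedDeriv i Real.cos (a * (-lam + x)))) := by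
  unfold cosOscillation
  rw [iteratedDeriv_const_mul_field, iteratedDeriv_const_add hi, iteratedDeriv_const_mul_field]
  have h := congrFun (iteratedDeriv_comp_const_add i (fun y => Real.cos (a * y)) (-lam)) x
  rw [h, iteratedDeriv_comp_const_mul Real.contDiff_cos]

theorem abs_iteratedDeriv_cosOscillation_le (k : ℕ) (lam x : ℝ) {a : ℝ} (ha : 0 < a) (i : ℕ) :
    |iteratedDeriv i (cosOscillation k lam a) x| ≤ 2 * ((a ^ (2 * k))⁻¹ * a ^ i) := by
  have hpos : 0 < (a ^ (2 * k))⁻¹ := by positivity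
  rcases Nat.eq_zero_or_pos i with rfl | hi
  · have h : |(-(-1) ^ k : ℝ) * Real.cos (a * (-lam + x))| ≤ 1 := by
      rw [abs_mul]; simpa using Real.abs_cos_le_one (a * (-lam + x))
    rw [iteratedDeriv_zero, abs_of_nonneg (cosOscillation_nonneg ..), cosOscillation]
    nlinarith [le_of_abs_le h]
  · rw [iteratedDeriv_cosOscillation k lam a x hi]
    have h := Real.abs_iteratedDeriv_cos_le_one i (a * (-lam + x))
    have hp : 0 < (a ^ (2 * k))⁻¹ * a ^ i := by positivity
    have hs : |(-(-1) ^ k : ℝ)| = 1 := by simp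
    rw [abs_mul, abs_mul, abs_mul, hs, abs_of_pos hpos, abs_of_pos (pow_pos ha i)]
    nlinarith

theorem iteratedDeriv_cosOscillation_self {k : ℕ} (hk : 0 < k) (lam : ℝ) {a : ℝ} (ha : 0 < a) :
    iteratedDeriv (2 * k) (cosOscillation k lam a) lam = -1 := by
  rw [iteratedDeriv_cosOscillation k lam a lam (by omega), Real.iteratedDeriv_even_cos]
  have h : ((-1 : ℝ) ^ k) * (-1) ^ k = 1 := by rw [← mul_pow]; simp
  have ha' : (a ^ (2 * k))⁻¹ * a ^ (2 * k) = 1 := inv_mul_cancel₀ (by positivity)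
  simp only [neg_add_cancel, mul_zero, Pi.mul_apply, Pi.pow_apply, Pi.neg_apply, Pi.one_apply,
    Real.cos_zero]
  linear_combination (-((-1 : ℝ) ^ k * (-1) ^ k)) * ha' - h

/-- A smooth step from `0` on `(-∞, -1/2]` to `1` on `[-1/4, ∞)`. -/
noncomputable def smoothStep (x : ℝ) : ℝ := Real.smoothTransition (4 * x + 2)

theorem contDiff_smoothStep {N : ℕ∞} : ContDiff ℝ N smoothStep :=
  Real.smoothTransition.contDiff.comp (by fun_prop)

theorem smoothStep_mul_eventuallyEq (g : ℝ → ℝ) {lam : ℝ} (hlam : 0 ≤ lam) :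
    (fun x => smoothStep x * g x) =ᶠ[𝓝 lam] g := by
  filter_upwards [Ioi_mem_nhds (show (-1 / 4 : ℝ) < lam by linarith)] with x hx
  have hx' : (-1 / 4 : ℝ) < x := hx
  rw [smoothStep, Real.smoothTransition.one_of_one_le (by linarith), one_mul]

theorem exists_bound_iteratedDeriv_smoothStep_mul (k : ℕ) (lam : ℝ) :
    ∃ K, ∀ a : ℝ, 1 ≤ a → ∀ x ∈ Set.Icc (-1 : ℝ) 1,
      |iteratedDeriv (2 * k) (fun x => smoothStep x * cosOscillation k lam a x) x| ≤ K := by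
  have hb : ∀ i : ℕ, ∃ C, ∀ x ∈ Set.Icc (-1 : ℝ) 1, ‖iteratedDeriv i smoothStep x‖ ≤ C :=
    fun i => isCompact_Icc.exists_bound_of_continuousOn
      (ContDiff.continuous_iteratedDeriv' i (contDiff_smoothStep (N := i))).continuousOn
  choose C hC using hb
  refine ⟨∑ i ∈ Finset.range (2 * k + 1), (2 * k).choose i * C i * 2, fun a ha x hx => ?_⟩
  have ha0 : 0 < a := by linarith
  rw [iteratedDeriv_fun_mul (contDiff_smoothStep (N := (2 * k : ℕ))).contDiffAt
    (contDiff_cosOscillation k lam a (N := (2 * k : ℕ))).contDiffAt]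
  refine (Finset.abs_sum_le_sum_abs _ _).trans (Finset.sum_le_sum fun i _ => ?_)
  rw [abs_mul, abs_mul, Nat.abs_cast]
  have h1 : |iteratedDeriv i smoothStep x| ≤ C i := hC i x hx
  have h2 : |iteratedDeriv (2 * k - i) (cosOscillation k lam a) x| ≤ 2 := by
    refine (abs_iteratedDeriv_cosOscillation_le k lam x ha0 _).trans ?_
    have : (a ^ (2 * k))⁻¹ * a ^ (2 * k - i) ≤ 1 := by
      rw [inv_mul_le_one₀ (by positivity)]
      exact pow_le_pow_right₀ ha (Nat.sub_le _ _)
    linarith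
  have h3 : 0 ≤ C i := (abs_nonneg _).trans h1
  gcongr

theorem abs_smoothStep_mul_cosOscillation_le (k : ℕ) (lam x : ℝ) {a : ℝ} (ha : 1 ≤ a) :
    |smoothStep x * cosOscillation k lam a x| ≤ 2 := by
  have h1 : |smoothStep x| ≤ 1 :=
    abs_le.2 ⟨by linarith [Real.smoothTransition.nonneg (4 * x + 2), smoothStep.eq_def x],
      Real.smoothTransition.le_one _⟩
  have h2 := abs_iteratedDeriv_cosOscillation_le k lam x (by linarith : 0 < a) 0
  have h3 : (a ^ (2 * k))⁻¹ ≤ 1 := inv_le_one_of_one_le₀ (one_le_pow₀ ha)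
  rw [iteratedDeriv_zero, pow_zero, mul_one] at h2
  rw [abs_mul]
  nlinarith [abs_nonneg (smoothStep x), abs_nonneg (cosOscillation k lam a x)]

theorem tendsto_iteratedDeriv_cosOscillation (k : ℕ) (lam x : ℝ) {i : ℕ} (hi : i < 2 * k)
    {a : ℕ → ℝ} (ha : ∀ m, 1 ≤ a m) (hlim : Tendsto a atTop atTop) :
    Tendsto (fun m => iteratedDeriv i (cosOscillation k lam (a m)) x) atTop (𝓝 0) := by
  have hinv : Tendsto (fun m => 2 * (a m)⁻¹) atTop (𝓝 0) := by
    simpa using (tendsto_inv_atTop_zero.comp hlim).const_mul 2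
  refine squeeze_zero_norm (fun m => ?_) hinv
  have h0 : 0 < a m := by linarith [ha m]
  refine (abs_iteratedDeriv_cosOscillation_le k lam x h0 i).trans ?_
  gcongr
  rw [inv_mul_le_iff₀ (by positivity), ← div_eq_mul_inv, le_div_iff₀ h0, ← pow_succ]
  exact pow_le_pow_right₀ (ha m) hi

/-- Copositive approximation with interpolatory constraints, negative result for
`f ∈ C^r` with even `r ≥ 2`: for any `n ≥ r`, `A > 0` and `λ ∈ [0,1]`, there is
`f ∈ C^r[-1,1]`, nonnegative on `[-1,1]` and vanishing on `[-1,-1/2]`, such that any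
polynomial of degree ≤ n, nonnegative on `(λ - 1/n, λ)`, with `P_n^{(i)}(λ) = f^{(i)}(λ)`
for `0 ≤ i ≤ r`, satisfies `‖f - P_n‖ > A ‖f^{(r)}‖`. -/
theorem statement11 (r : ℕ) (hr : 2 ≤ r) (hre : Even r) (n : ℕ) (hn : r ≤ n)
    (A : ℝ) (hA : 0 < A) (lam : ℝ) (hlam : lam ∈ Set.Icc (0 : ℝ) 1) :
    ∃ f : ℝ → ℝ, ContDiffOn ℝ r f (Set.Icc (-1 : ℝ) 1) ∧
      (∀ x ∈ Set.Icc (-1 : ℝ) 1, 0 ≤ f x) ∧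
      (∀ x ∈ Set.Icc (-1 : ℝ) (-1/2 : ℝ), f x = 0) ∧
      ∀ P : Polynomial ℝ, P.natDegree ≤ n →
        (∀ x ∈ Set.Ioo (lam - 1 / n) lam, 0 ≤ P.eval x) →
        (∀ i : ℕ, i ≤ r → (Polynomial.derivative^[i] P).eval lam
            = iteratedDerivWithin i f (Set.Icc (-1 : ℝ) 1) lam) →
        A * supNorm (iteratedDerivWithin r f (Set.Icc (-1 : ℝ) 1)) (-1) 1
          < supNorm (fun x => f x - P.eval x) (-1) 1 := by
  obtain ⟨k, rfl⟩ := hre.exists_two_nsmul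
  rw [smul_eq_mul] at *
  by_contra! hcon
  obtain ⟨K, hK⟩ := exists_bound_iteratedDeriv_smoothStep_mul k lam
  have hlamI : lam ∈ Set.Icc (-1 : ℝ) 1 := ⟨by linarith [hlam.1], hlam.2⟩
  let a : ℕ → ℝ := fun m => m + 1
  have ha : ∀ m, 1 ≤ a m := fun m => by simp [a]
  have halim : Tendsto a atTop atTop :=
    tendsto_atTop_add_const_right _ _ tendsto_natCast_atTop_atTop
  let f : ℕ → ℝ → ℝ := fun m x => smoothStep x * cosOscillation k lam (a m) x
  have hf : ∀ m, ContDiff ℝ (2 * k : ℕ) (f m) := fun m =>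
    (contDiff_smoothStep (N := (2 * k : ℕ))).mul (contDiff_cosOscillation k lam (a m))
  have hwithin : ∀ m i, i ≤ 2 * k → ∀ x ∈ Set.Icc (-1 : ℝ) 1,
      iteratedDerivWithin i (f m) (Set.Icc (-1 : ℝ) 1) x = iteratedDeriv i (f m) x :=
    fun m i hi x hx => iteratedDerivWithin_eq_iteratedDeriv (uniqueDiffOn_Icc (by norm_num))
      ((hf m).of_le (by exact_mod_cast hi)).contDiffAt hx
  have hfam := fun m => hcon (f m) (hf m).contDiffOn
    (fun x _ => mul_nonneg (Real.smoothTransition.nonneg _) (cosOscillation_nonneg ..))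
    (fun x hx => by
      simp only [f, smoothStep]
      rw [Real.smoothTransition.zero_of_nonpos (by linarith [hx.2]), zero_mul])
  choose P hdeg hpos hder hsup using hfam
  have hbound : ∀ m, ∀ x ∈ Set.Icc (-1 : ℝ) 1, |(P m).eval x| ≤ 2 + A * K := by
    intro m x hx
    have h1 : |f m x - (P m).eval x| ≤ A * K :=
      calc |f m x - (P m).eval x| ≤ supNorm (fun x => f m x - (P m).eval x) (-1) 1 :=
            abs_le_supNorm (g := fun x => f m x - (P m).eval x)
              ((hf m).continuous.sub (P m).continuous).continuousOn hx
        _ ≤ _ := hsup m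
        _ ≤ A * K := by
          gcongr
          refine supNorm_le_of_forall_abs_le (by norm_num) fun y hy => ?_
          rw [hwithin m _ le_rfl y hy]
          exact hK _ (ha m) y hy
    have h2 : |f m x| ≤ 2 := abs_smoothStep_mul_cosOscillation_le k lam x (ha m)
    have h3 := abs_sub_abs_le_abs_sub ((P m).eval x) (f m x)
    rw [abs_sub_comm] at h3
    linarith
  obtain ⟨Q, φ, hφ, hQ⟩ := exists_subseq_tendsto_of_bounded P hdeg hbound
  have hderQ : ∀ i, Tendsto (fun m => (derivative^[i] (P (φ m))).eval lam) atTop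
      (𝓝 ((derivative^[i] Q).eval lam)) := fun i => by
    simpa [Module.End.pow_apply] using hQ ((leval lam).comp (derivative ^ i))
  have hosc : ∀ m i, i ≤ 2 * k → (derivative^[i] (P m)).eval lam =
      iteratedDeriv i (cosOscillation k lam (a m)) lam := fun m i hi => by
    rw [hder m i hi, hwithin m i hi lam hlamI]
    exact (smoothStep_mul_eventuallyEq _ hlam.1).iteratedDeriv_eq i
  have hzero : ∀ i < 2 * k, (derivative^[i] Q).eval lam = 0 := fun i hi =>
    tendsto_nhds_unique (hderQ i) (by
      simp_rw [hosc _ i hi.le]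
      exact tendsto_iteratedDeriv_cosOscillation k lam lam hi (fun m => ha (φ m))
        (halim.comp hφ.tendsto_atTop))
  have hneg : (derivative^[2 * k] Q).eval lam = -1 :=
    tendsto_nhds_unique (hderQ (2 * k)) (by
      simp_rw [hosc _ _ le_rfl, fun m => iteratedDeriv_cosOscillation_self
        (k := k) (by omega) lam (zero_lt_one.trans_le (ha m))]
      exact tendsto_const_nhds)
  have hn0 : (0 : ℝ) < 1 / n := by
    have : 0 < n := by omega
    positivity
  have hnonneg := eval_iterate_derivative_nonneg (even_two_mul k) hn0
    (fun x hx => ge_of_tendsto' (hQ (leval x)) fun m => hpos (φ m) x hx) hzero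
  linarith
end

section
/- Let r, k ∈ ℕ. Then there exists a constant c > 0 depending only on k and r such that for every interval [a,b], every f ∈ C^r[a,b] and every λ ∈ [a,b], there exists a polynomial p of degree ≤ k + r - 1 satisfying: p^(i)(λ) = f^(i)(λ) for all 0 ≤ i ≤ r-1; the estimate ‖f - p‖_{[a,b]} ≤ c (b-a)^r ω_k(f^(r), b-a; [a,b]); and the sign conditions: (i) if λ ∈ (a,b), then p(x) - f(x) ≥ 0 for all x ∈ [λ, b] and (-1)^r (p(x) - f(x)) ≥ 0 for all x ∈ [a, λ]; (ii) if λ = a, then p(x) - f(x) ≥ 0 for all x ∈ [a, b]; (iii) if λ = b, then (-1)^r (p(x) - f(x)) ≥ 0 for all x ∈ [a, b]. -/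
/-- The `k`-th forward difference of `f` at `x` with step `h`, as an explicit sum. -/
noncomputable def kdiff (k : ℕ) (f : ℝ → ℝ) (x h : ℝ) : ℝ :=
  ∑ i ∈ Finset.range (k + 1), (-1 : ℝ) ^ (k - i) * (k.choose i : ℝ) * f (x + (i : ℝ) * h)

lemma kdiff_sub (k : ℕ) (f g : ℝ → ℝ) (x h : ℝ) :
    kdiff k (fun t => f t - g t) x h = kdiff k f x h - kdiff k g x h := by
  simp only [kdiff, mul_sub, Finset.sum_sub_distrib]

lemma kdiff_mul_left (k : ℕ) (c : ℝ) (f : ℝ → ℝ) (x h : ℝ) :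
    kdiff k (fun t => c * f t) x h = c * kdiff k f x h := by
  simp only [kdiff, Finset.mul_sum]
  exact Finset.sum_congr rfl fun i _ => by ring

lemma kdiff_eval_eq_zero {k : ℕ} {p : Polynomial ℝ} (hp : p.natDegree < k) (x h : ℝ) :
    kdiff k (fun t => p.eval t) x h = 0 := by
  have hq : (p.comp (Polynomial.C h * Polynomial.X + Polynomial.C x)).natDegree < k := by
    refine lt_of_le_of_lt (Polynomial.natDegree_comp_le.trans ?_) hp
    exact (Nat.mul_le_mul_left _ (Polynomial.natDegree_linear_le)).trans (by simp)
  have := congr_fun (Polynomial.fwdDiff_iter_eq_zero_of_degree_lt hq) 0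
  rw [fwdDiff_iter_eq_sum_shift] at this
  rw [← this.trans (Pi.zero_apply _), kdiff]
  refine Finset.sum_congr rfl fun i _ => ?_
  simp [add_comm x, mul_comm h]

lemma kdiff_zero_step {k : ℕ} (hk : 1 ≤ k) (f : ℝ → ℝ) (x : ℝ) : kdiff k f x 0 = 0 := by
  have := kdiff_eval_eq_zero (k := k) (p := Polynomial.C (f x)) (by simpa [Nat.pos_iff_ne_zero, Nat.one_le_iff_ne_zero] using hk) x 0
  simpa [kdiff] using this

lemma kdiff_reverse (k : ℕ) (f : ℝ → ℝ) (x h : ℝ) :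
    kdiff k f x (-h) = (-1) ^ k * kdiff k f (x - k * h) h := by
  rw [kdiff, ← Finset.sum_range_reflect, kdiff, Finset.mul_sum]
  refine Finset.sum_congr rfl fun i hi => ?_
  have hi : i ≤ k := Nat.lt_succ_iff.mp (Finset.mem_range.mp hi)
  have h1 : k + 1 - 1 - i = k - i := by omega
  have h2 : k - (k - i) = i := by omega
  have h3 : (-1 : ℝ) ^ k * (-1) ^ (k - i) = (-1) ^ i := by
    conv_lhs => rw [← Nat.sub_add_cancel hi]
    rw [Nat.add_sub_cancel, pow_add, mul_right_comm, ← mul_pow]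
    simp
  rw [h1, h2, Nat.choose_symm hi, ← mul_assoc, ← mul_assoc, h3]
  congr 2
  rw [Nat.cast_sub hi]
  ring

lemma abs_kdiff_le {k : ℕ} {f : ℝ → ℝ} {x h M : ℝ}
    (hM : ∀ i ≤ k, |f (x + (i : ℝ) * h)| ≤ M) : |kdiff k f x h| ≤ 2 ^ k * M := by
  calc |kdiff k f x h|
      ≤ ∑ i ∈ Finset.range (k + 1), (k.choose i : ℝ) * M := by
        refine (Finset.abs_sum_le_sum_abs _ _).trans (Finset.sum_le_sum fun i hi => ?_)
        rw [abs_mul, abs_mul, abs_pow, abs_neg, abs_one, one_pow, one_mul, Nat.abs_cast]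
        exact mul_le_mul_of_nonneg_left (hM i (Nat.lt_succ_iff.mp (Finset.mem_range.mp hi)))
          (Nat.cast_nonneg _)
    _ = 2 ^ k * M := by
        rw [← Finset.sum_mul]
        congr 1
        exact_mod_cast Nat.sum_range_choose k

/-- A continuous function with vanishing `k`-th differences on `[0,1]` and zeros at the points
`i / k`, `i < k`, vanishes on `[0,1]`. -/
lemma eq_zero_of_kdiff_eq_zero {k : ℕ} (hk : 1 ≤ k) {f : ℝ → ℝ} (hf : Continuous f)
    (hd : ∀ x h : ℝ, 0 ≤ x → 0 < h → x + k * h ≤ 1 → kdiff k f x h = 0)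
    (hz : ∀ i < k, f ((i : ℝ) / k) = 0) : ∀ x ∈ Set.Icc (0 : ℝ) 1, f x = 0 := by
  have hk0 : (0 : ℝ) < k := by exact_mod_cast hk
  have grid : ∀ m : ℕ, 1 ≤ m → ∀ i ≤ k * m, f ((i : ℝ) / (k * m : ℕ)) = 0 := by
    intro m hm
    have hN : (0 : ℝ) < (k * m : ℕ) := by exact_mod_cast Nat.mul_pos hk hm
    have hm0 : (0 : ℝ) < m := by exact_mod_cast hm
    set N := k * m with hNdef
    set v : ℕ → ℝ := fun i => (i : ℝ) / N with hv
    have hvi : Function.Injective v := fun i j hij => by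
      simpa [hv, div_left_inj' hN.ne'] using hij
    set P := Lagrange.interpolate (Finset.range k) v (fun i => f (v i)) with hP
    have hPd : P.degree < k := by
      simpa only [Finset.card_range] using Lagrange.degree_interpolate_lt (fun i => f (v i))
        (hvi.injOn (s := (Finset.range k : Set ℕ)))
    have hPn : P.natDegree < k := by
      by_cases h0 : P = 0
      · rw [h0]; exact hk
      · exact (Polynomial.natDegree_lt_iff_degree_lt h0).2 hPd
    have hfP : ∀ i ≤ N, f (v i) = P.eval (v i) := by
      intro i
      induction i using Nat.strong_induction_on with
      | _ i ih =>
        intro hi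
        rcases lt_or_ge i k with h | h
        · exact (Lagrange.eval_interpolate_at_node (fun i => f (v i)) hvi.injOn
            (Finset.mem_range.2 h)).symm
        · obtain ⟨j, rfl⟩ := Nat.exists_eq_add_of_le' h
          have hadd : ∀ l : ℕ, v j + (l : ℝ) * (1 / N) = v (j + l) := fun l => by
            simp only [hv]; push_cast; ring
          have h1 := hd (v j) (1 / N) (by positivity) (by positivity) (by
            rw [hadd]; simp only [hv]; rw [div_le_one hN]; exact_mod_cast hi)
          have h2 := kdiff_sub k f (fun t => P.eval t) (v j) (1 / N)
          rw [h1, kdiff_eval_eq_zero hPn, sub_zero, kdiff, Finset.sum_range_succ,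
            Finset.sum_eq_zero] at h2
          · simp only [hadd] at h2
            simpa [sub_eq_zero] using h2
          · intro l hl
            have hl := Finset.mem_range.1 hl
            simp only [hadd]
            rw [ih (j + l) (by omega) (by omega), sub_self, mul_zero]
    have hP0 : P = 0 := by
      have hinj : Function.Injective (fun i : ℕ => (i : ℝ) / k) := fun i j hij => by
        simpa [div_left_inj' hk0.ne'] using hij
      refine Polynomial.eq_zero_of_degree_lt_of_eval_index_eq_zero
        (v := fun i : ℕ => (i : ℝ) / (k : ℝ)) (Finset.range k) hinj.injOn (by simpa using hPd) fun i hi => ?_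
      have hi := Finset.mem_range.1 hi
      have e : (i : ℝ) / k = v (i * m) := by
        simp only [hv, hNdef]; push_cast; field_simp
      rw [← hz i hi, e, hfP _ (Nat.mul_le_mul_right m hi.le)]
    intro i hi
    have := hfP i hi
    rwa [hP0, Polynomial.eval_zero] at this
  intro x hx
  have ht : Filter.Tendsto (fun n : ℕ => ((⌊x * (n : ℝ)⌋₊ : ℝ)) / (n : ℝ)) Filter.atTop (nhds x) :=
    (tendsto_nat_floor_mul_div_atTop hx.1).comp tendsto_natCast_atTop_atTop
  refine tendsto_nhds_unique ((hf.tendsto x).comp ht) (tendsto_const_nhds.congr' ?_)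
  filter_upwards [Filter.eventually_ge_atTop 1] with n hn
  have hn0 : (0 : ℝ) < n := by exact_mod_cast hn
  have hfl : ⌊x * (n : ℝ)⌋₊ ≤ n := by
    refine Nat.floor_le_of_le ?_
    nlinarith [hx.2]
  have := grid n hn (k * ⌊x * (n : ℝ)⌋₊) (Nat.mul_le_mul_left k hfl)
  rw [Function.comp_apply, ← this]
  congr 1
  push_cast
  field_simp

/-- Averaging the `k`-th difference over the step bounds `f x` by the difference and a primitive. -/
lemma abs_le_of_abs_kdiff_le {k : ℕ} (hk : 1 ≤ k) {F f : ℝ → ℝ}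
    (hF : ∀ x, HasDerivAt F (f x) x) {x s H w M : ℝ} (hs : |s| = 1) (hH : 0 < H)
    (hw : ∀ h, 0 < h → h ≤ H → |kdiff k f x (s * h)| ≤ w)
    (hM : ∀ i ≤ k, |F (x + (i : ℝ) * (s * H))| ≤ M) :
    |f x| ≤ w + 2 ^ (k + 1) * M / H := by
  have hs0 : s ≠ 0 := by rintro rfl; simp at hs
  have hw0 : 0 ≤ w := (abs_nonneg _).trans (hw H hH le_rfl)
  have hM0 : 0 ≤ M := (abs_nonneg _).trans (hM 0 (Nat.zero_le _))
  set S : ℝ → ℝ := fun h => ∑ i ∈ Finset.range k,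
    (-1 : ℝ) ^ (k - (i + 1)) * (k.choose (i + 1) : ℝ) *
      ((F (x + ((i + 1 : ℕ) : ℝ) * (s * h)) - F x) / (((i + 1 : ℕ) : ℝ) * s)) with hS
  have hder : ∀ h : ℝ, HasDerivAt (fun h => S h + (-1) ^ k * f x * h) (kdiff k f x (s * h)) h := by
    intro h
    have : kdiff k f x (s * h) = (∑ i ∈ Finset.range k,
        (-1 : ℝ) ^ (k - (i + 1)) * (k.choose (i + 1) : ℝ) *
          ((f (x + ((i + 1 : ℕ) : ℝ) * (s * h)) * (((i + 1 : ℕ) : ℝ) * s)) /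
            (((i + 1 : ℕ) : ℝ) * s))) + (-1) ^ k * f x * 1 := by
      rw [kdiff, Finset.sum_range_succ']
      congr 1
      · refine Finset.sum_congr rfl fun i _ => ?_
        rw [mul_div_cancel_right₀]
        positivity
      · simp
    rw [this]
    refine HasDerivAt.add (HasDerivAt.fun_sum fun i _ => ?_) ((hasDerivAt_id h).const_mul _)
    refine HasDerivAt.const_mul _ (HasDerivAt.div_const (HasDerivAt.sub_const _ ?_) _)
    refine (hF _).comp h ?_
    have := (((hasDerivAt_id h).const_mul s).const_mul ((i + 1 : ℕ) : ℝ)).const_add x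
    simpa using this
  have hmv := norm_image_sub_le_of_norm_deriv_le_segment' (C := w) (a := 0) (b := H)
    (fun h _ => (hder h).hasDerivWithinAt) (fun h hh => by
      rcases hh.1.eq_or_lt with h0 | h0
      · rw [← h0, mul_zero, kdiff_zero_step hk]; simpa using hw0
      · exact hw h h0 hh.2.le) H ⟨hH.le, le_rfl⟩
  have hS0 : S 0 = 0 := by simp [hS]
  simp only [hS0, mul_zero, add_zero, sub_zero, Real.norm_eq_abs] at hmv
  have hSH : |S H| ≤ 2 ^ (k + 1) * M := by
    calc |S H| ≤ ∑ i ∈ Finset.range k, (k.choose (i + 1) : ℝ) * (2 * M) := by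
          refine (Finset.abs_sum_le_sum_abs _ _).trans (Finset.sum_le_sum fun i hi => ?_)
          rw [abs_mul, abs_mul, abs_pow, abs_neg, abs_one, one_pow, one_mul, Nat.abs_cast]
          refine mul_le_mul_of_nonneg_left ?_ (Nat.cast_nonneg _)
          rw [abs_div, abs_mul, hs, mul_one, Nat.abs_cast]
          have h1 := hM (i + 1) (Finset.mem_range.1 hi)
          have h2 := hM 0 (Nat.zero_le _)
          simp only [Nat.cast_zero, zero_mul, add_zero] at h2
          refine (div_le_self (abs_nonneg _) (by exact_mod_cast Nat.le_add_left 1 i)).trans ?_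
          exact (abs_sub _ _).trans (by linarith)
      _ ≤ ∑ i ∈ Finset.range (k + 1), (k.choose i : ℝ) * (2 * M) := by
          rw [Finset.sum_range_succ']
          exact le_add_of_nonneg_right (by positivity)
      _ = 2 ^ (k + 1) * M := by
          have : ∑ i ∈ Finset.range (k + 1), (k.choose i : ℝ) = 2 ^ k := by
            exact_mod_cast Nat.sum_range_choose k
          rw [← Finset.sum_mul, this]
          ring
  have hfx : |f x| * H = |(-1) ^ k * f x * H| := by
    simp [abs_mul, abs_of_pos hH]
  have : |f x| * H ≤ w * H + 2 ^ (k + 1) * M := by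
    rw [hfx]
    calc |(-1) ^ k * f x * H| = |(S H + (-1) ^ k * f x * H) - S H| := by congr 1; ring
      _ ≤ _ := (abs_sub _ _).trans (add_le_add hmv hSH)
  rw [← sub_le_iff_le_add', le_div_iff₀ hH]
  linarith

/-- A continuous function on `[0,1]` is controlled by its `k`-th differences and the values of its
primitive on a sufficiently fine grid. -/
lemma abs_le_of_abs_integral_grid_le {k N : ℕ} (hk : 1 ≤ k) (hN : 1 ≤ N) {f : ℝ → ℝ}
    (hf : Continuous f) {B w m : ℝ} (hB : ∀ x ∈ Set.Icc (0 : ℝ) 1, |f x| ≤ B)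
    (hw : ∀ x h : ℝ, 0 ≤ x → 0 < h → x + k * h ≤ 1 → |kdiff k f x h| ≤ w)
    (hm : ∀ i ≤ N, |∫ t in (0 : ℝ)..((i : ℝ) / N), f t| ≤ m) :
    ∀ x ∈ Set.Icc (0 : ℝ) 1, |f x| ≤ w + 2 ^ (k + 1) * (m + B / N) / (1 / (2 * k)) := by
  have hk0 : (0 : ℝ) < k := by exact_mod_cast hk
  have hN0 : (0 : ℝ) < N := by exact_mod_cast hN
  have hB0 : 0 ≤ B := (abs_nonneg _).trans (hB 0 (by simp))
  set F : ℝ → ℝ := fun x => ∫ t in (0 : ℝ)..x, f t with hFdef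
  have hF : ∀ x, HasDerivAt F (f x) x := fun x =>
    intervalIntegral.integral_hasDerivAt_right (hf.intervalIntegrable _ _)
      (hf.stronglyMeasurableAtFilter _ _) hf.continuousAt
  have hFM : ∀ x ∈ Set.Icc (0 : ℝ) 1, |F x| ≤ m + B / N := by
    intro x hx
    have hxN : 0 ≤ x * N := mul_nonneg hx.1 hN0.le
    set i := ⌊x * N⌋₊ with hi
    have h1 : (i : ℝ) ≤ x * N := Nat.floor_le hxN
    have h2 : x * N < i + 1 := Nat.lt_floor_add_one _
    have hiN : i ≤ N := Nat.floor_le_of_le (by nlinarith [hx.2])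
    have h3 : (i : ℝ) / N ≤ x := by rwa [div_le_iff₀ hN0]
    have h4 : x - (i : ℝ) / N ≤ 1 / N := by
      rw [sub_le_iff_le_add, ← add_div, le_div_iff₀ hN0]; linarith
    have h0 : 0 ≤ (i : ℝ) / N := by positivity
    have hsub : F x - F ((i : ℝ) / N) = ∫ t in ((i : ℝ) / N)..x, f t :=
      intervalIntegral.integral_interval_sub_left (hf.intervalIntegrable _ _)
        (hf.intervalIntegrable _ _)
    have hle : ‖∫ t in ((i : ℝ) / N)..x, f t‖ ≤ B * |x - (i : ℝ) / N| := by
      refine intervalIntegral.norm_integral_le_of_norm_le_const fun t ht => ?_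
      rw [Set.uIoc_of_le h3] at ht
      exact hB t ⟨h0.trans ht.1.le, ht.2.trans hx.2⟩
    rw [← hsub, Real.norm_eq_abs, abs_of_nonneg (sub_nonneg.2 h3)] at hle
    calc |F x| = |F ((i : ℝ) / N) + (F x - F ((i : ℝ) / N))| := by congr 1; ring
      _ ≤ m + B / N := by
        refine (abs_add_le _ _).trans (add_le_add (hm i hiN) (hle.trans ?_))
        rw [div_eq_mul_one_div B]
        exact mul_le_mul_of_nonneg_left h4 hB0
  intro x hx
  have hH : (0 : ℝ) < 1 / (2 * k) := by positivity
  have key : ∀ h : ℝ, h ≤ 1 / (2 * k) → k * h ≤ 1 / 2 := fun h hh => by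
    rw [le_div_iff₀ (by positivity)] at hh
    linarith
  have key' : ∀ i ≤ k, (i : ℝ) * (1 / (2 * k)) ≤ 1 / 2 := fun i hi =>
    (mul_le_mul_of_nonneg_right (by exact_mod_cast hi) hH.le).trans (key _ le_rfl)
  rcases le_total x (1 / 2) with hx2 | hx2
  · refine abs_le_of_abs_kdiff_le hk hF (s := 1) (by simp) hH (fun h h0 hh => ?_) fun i hi => ?_
    · rw [one_mul]
      exact hw x h hx.1 h0 (by linarith [key h hh])
    · rw [one_mul]
      have : 0 ≤ (i : ℝ) * (1 / (2 * k)) := by positivity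
      exact hFM _ ⟨by linarith [hx.1], by linarith [key' i hi]⟩
  · refine abs_le_of_abs_kdiff_le hk hF (s := -1) (by simp) hH (fun h h0 hh => ?_) fun i hi => ?_
    · rw [neg_one_mul, kdiff_reverse, abs_mul, abs_pow, abs_neg, abs_one, one_pow, one_mul]
      exact hw _ h (by linarith [key h hh]) h0 (by linarith [hx.2])
    · rw [neg_one_mul, mul_neg]
      have : 0 ≤ (i : ℝ) * (1 / (2 * k)) := by positivity
      exact hFM _ ⟨by linarith [key' i hi], by linarith [hx.2]⟩

/-- **Whitney's inequality** on `[0,1]` for functions vanishing at the points `i / k`, `i < k`. -/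
lemma exists_abs_le_mul_of_vanishing {k : ℕ} (hk : 1 ≤ k) :
    ∃ C : ℝ, 0 < C ∧ ∀ (f : ℝ → ℝ) (w : ℝ), ContinuousOn f (Set.Icc 0 1) →
      (∀ x h : ℝ, 0 ≤ x → 0 < h → x + k * h ≤ 1 → |kdiff k f x h| ≤ w) →
      (∀ i < k, f ((i : ℝ) / k) = 0) → ∀ x ∈ Set.Icc (0 : ℝ) 1, |f x| ≤ C * w := by
  have hk0 : (0 : ℝ) < k := by exact_mod_cast hk
  have h01 : (0 : ℝ) ≤ 1 := zero_le_one
  -- the extension of a function on `[0,1]` to the line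
  let e : C(unitInterval, ℝ) → ℝ → ℝ := fun g => Set.IccExtend h01 g
  have e_cont : ∀ g, Continuous (e g) := fun g => g.continuous.Icc_extend'
  have e_le : ∀ g x, |e g x| ≤ ‖g‖ := fun g x => g.norm_coe_le_norm _
  have e_sub : ∀ g₁ g₂, e (g₁ - g₂) = fun t => e g₁ t - e g₂ t := fun _ _ => rfl
  set K : ℕ := 2 ^ (k + 2) * k with hK
  have hK1 : 1 ≤ K := Nat.mul_pos (by positivity) hk
  have hK0 : (0 : ℝ) < K := by exact_mod_cast hK1
  let L : C(unitInterval, ℝ) → Fin (2 * K + 1) → ℝ :=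
    fun g i => ∫ t in (0 : ℝ)..((i : ℝ) / (2 * K : ℕ)), e g t
  have L_sub : ∀ g₁ g₂, L (g₁ - g₂) = L g₁ - L g₂ := fun g₁ g₂ => by
    funext i
    simp only [L, e_sub, Pi.sub_apply]
    exact intervalIntegral.integral_sub ((e_cont _).intervalIntegrable _ _)
      ((e_cont _).intervalIntegrable _ _)
  have main : ∀ (g : C(unitInterval, ℝ)) (w : ℝ),
      (∀ x h : ℝ, 0 ≤ x → 0 < h → x + k * h ≤ 1 → |kdiff k (e g) x h| ≤ w) →
      ‖g‖ ≤ 2 * w + 2 * K * ‖L g‖ := by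
    intro g w hw
    have h1 := abs_le_of_abs_integral_grid_le (N := 2 * K) hk (by omega) (e_cont g)
      (fun x _ => e_le g x) hw (m := ‖L g‖) (fun i hi => by
        exact norm_le_pi_norm (L g) ⟨i, Nat.lt_succ_of_le hi⟩)
    have h2 : ‖g‖ ≤ w + 2 ^ (k + 1) * (‖L g‖ + ‖g‖ / (2 * K : ℕ)) / (1 / (2 * k)) := by
      refine (ContinuousMap.norm_le_of_nonempty _).2 fun x => ?_
      have := h1 x x.2
      simpa only [e, Set.IccExtend_val, Real.norm_eq_abs] using this
    have h3 : 2 ^ (k + 1) * (‖L g‖ + ‖g‖ / (2 * K : ℕ)) / (1 / (2 * k)) =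
        K * ‖L g‖ + ‖g‖ / 2 := by
      have : (K : ℝ) = 2 ^ (k + 1) * (2 * k) := by rw [hK]; push_cast; ring
      have h4 : 2 ^ (k + 1) * (‖L g‖ + ‖g‖ / (2 * K : ℕ)) / (1 / (2 * k)) =
        K * (‖L g‖ + ‖g‖ / (2 * K : ℕ)) := by rw [this]; field_simp
      rw [h4]; push_cast; field_simp
    linarith
  by_contra! hcon
  have hseq : ∀ n : ℕ, ∃ g : C(unitInterval, ℝ), ‖g‖ = 1 ∧
      (∀ x h : ℝ, 0 ≤ x → 0 < h → x + k * h ≤ 1 → |kdiff k (e g) x h| ≤ 1 / ((n : ℝ) + 1)) ∧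
      ∀ i < k, e g ((i : ℝ) / k) = 0 := by
    intro n
    obtain ⟨f, w, hf, hw, hz, x, hx, hlt⟩ := hcon ((n : ℝ) + 1) (by positivity)
    let g : C(unitInterval, ℝ) := ⟨Set.domRestrict (Set.Icc 0 1) f, hf.domRestrict⟩
    have hw0 : 0 ≤ w := (abs_nonneg _).trans
      (hw 0 (1 / k) le_rfl (by positivity) (by field_simp; simp))
    have hge : ∀ y ∈ Set.Icc (0 : ℝ) 1, e g y = f y := fun y hy =>
      Set.IccExtend_of_mem h01 _ hy
    have hgn : ((n : ℝ) + 1) * w < ‖g‖ := hlt.trans_le (by rw [← hge x hx]; exact e_le g x)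
    have hg0 : 0 < ‖g‖ := (by positivity : 0 ≤ ((n : ℝ) + 1) * w).trans_lt hgn
    have hes : e (‖g‖⁻¹ • g) = fun t => ‖g‖⁻¹ * e g t := rfl
    refine ⟨‖g‖⁻¹ • g, ?_, fun y h hy hh hyh => ?_, fun i hi => ?_⟩
    · rw [norm_smul, norm_inv, norm_norm, inv_mul_cancel₀ hg0.ne']
    · have : kdiff k (e g) y h = kdiff k f y h := by
        refine Finset.sum_congr rfl fun i hi => ?_
        have hi : (i : ℝ) ≤ k := by exact_mod_cast Nat.lt_succ_iff.mp (Finset.mem_range.mp hi)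
        rw [hge _ ⟨by positivity, by nlinarith⟩]
      rw [hes, kdiff_mul_left, this, abs_mul, abs_inv, abs_norm, inv_mul_le_iff₀ hg0,
        mul_one_div, le_div_iff₀ (by positivity)]
      nlinarith [hw y h hy hh hyh]
    · have hi' : (i : ℝ) / k ∈ Set.Icc (0 : ℝ) 1 :=
        ⟨by positivity, by rw [div_le_one hk0]; exact_mod_cast hi.le⟩
      simp only [hes, hge _ hi', hz i hi, mul_zero]
  choose g hg1 hgw hgz using hseq
  have hLb : ∀ n, L (g n) ∈ Metric.closedBall (0 : Fin (2 * K + 1) → ℝ) 1 := by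
    intro n
    rw [mem_closedBall_zero_iff, pi_norm_le_iff_of_nonneg zero_le_one]
    intro i
    have hi : (i : ℝ) ≤ (2 * K : ℕ) := by exact_mod_cast Nat.lt_succ_iff.mp i.2
    have h0 : (0 : ℝ) ≤ (i : ℝ) / (2 * K : ℕ) := by positivity
    have h1 : (i : ℝ) / (2 * K : ℕ) ≤ 1 := div_le_one_of_le₀ hi (by positivity)
    refine (intervalIntegral.norm_integral_le_of_norm_le_const (C := 1)
      fun t _ => (e_le _ t).trans (hg1 n).le).trans ?_
    rwa [sub_zero, abs_of_nonneg h0, one_mul]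
  obtain ⟨a, -, φ, hφ, hconv⟩ := tendsto_subseq_of_bounded Metric.isBounded_closedBall hLb
  have hcau : CauchySeq (g ∘ φ) := by
    rw [Metric.cauchySeq_iff]
    intro ε hε
    obtain ⟨N₁, hN₁⟩ := Metric.cauchySeq_iff.1 hconv.cauchySeq (ε / (4 * K)) (by positivity)
    obtain ⟨N₂, hN₂⟩ := exists_nat_one_div_lt (show (0 : ℝ) < ε / 8 by positivity)
    refine ⟨max N₁ N₂, fun m hm n hn => ?_⟩
    have hsmall : ∀ l ≥ max N₁ N₂, 1 / (((φ l : ℕ) : ℝ) + 1) < ε / 8 := fun l hl =>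
      (one_div_le_one_div_of_le (by positivity) (by
        have : N₂ ≤ φ l := (le_of_max_le_right hl).trans (hφ.id_le l)
        have : (N₂ : ℝ) ≤ φ l := by exact_mod_cast this
        linarith)).trans_lt hN₂
    have h1 := main (g (φ m) - g (φ n)) (1 / (((φ m : ℕ) : ℝ) + 1) + 1 / (((φ n : ℕ) : ℝ) + 1))
      (fun x h hx hh hxh => by
        rw [e_sub, kdiff_sub]
        exact (abs_sub _ _).trans (add_le_add (hgw _ x h hx hh hxh) (hgw _ x h hx hh hxh)))
    have h2 := hN₁ m (le_of_max_le_left hm) n (le_of_max_le_left hn)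
    rw [dist_eq_norm, Function.comp_apply, Function.comp_apply, ← L_sub,
      lt_div_iff₀ (by positivity)] at h2
    rw [dist_eq_norm, Function.comp_apply, Function.comp_apply]
    linarith [hsmall m hm, hsmall n hn]
  obtain ⟨G, hG⟩ := cauchySeq_tendsto_of_complete hcau
  have hGn : ‖G‖ = 1 := by
    refine tendsto_nhds_unique hG.norm ?_
    simp only [Function.comp_apply, hg1]
    exact tendsto_const_nhds
  have hGe : ∀ x, Filter.Tendsto (fun n => e (g (φ n)) x) Filter.atTop (nhds (e G x)) := fun x =>
    ((continuous_eval_const (Set.projIcc 0 1 h01 x)).tendsto G).comp hG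
  have hGz : ∀ i < k, e G ((i : ℝ) / k) = 0 := fun i hi => by
    refine tendsto_nhds_unique (hGe _) ?_
    simp only [hgz _ i hi]
    exact tendsto_const_nhds
  have hGd : ∀ x h : ℝ, 0 ≤ x → 0 < h → x + k * h ≤ 1 → kdiff k (e G) x h = 0 := by
    intro x h hx hh hxh
    have h1 : Filter.Tendsto (fun n => kdiff k (e (g (φ n))) x h) Filter.atTop
        (nhds (kdiff k (e G) x h)) :=
      tendsto_finsetSum _ fun i _ => (hGe _).const_mul _
    refine tendsto_nhds_unique h1 (squeeze_zero_norm (fun n => hgw (φ n) x h hx hh hxh) ?_)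
    exact tendsto_one_div_add_atTop_nhds_zero_nat.comp hφ.tendsto_atTop
  have hG0 : G = 0 := by
    ext x
    have := eq_zero_of_kdiff_eq_zero hk (e_cont G) hGd hGz x x.2
    simpa only [e, Set.IccExtend_val, ContinuousMap.zero_apply] using this
  rw [hG0, norm_zero] at hGn
  exact zero_ne_one hGn

lemma abs_kdiff_le_omegaK {k : ℕ} {g : ℝ → ℝ} {a b : ℝ} (hg : ContinuousOn g (Set.Icc a b))
    {t x h : ℝ} (h0 : 0 < h) (ht : h ≤ t) (hx : a ≤ x) (hxh : x + k * h ≤ b) :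
    |kdiff k g x h| ≤ omegaK g k t a b := by
  obtain ⟨M, hM⟩ := isCompact_Icc.exists_bound_of_continuousOn hg
  refine le_csSup ⟨2 ^ k * M, ?_⟩ ⟨h, x, h0, ht, hx, hxh, rfl⟩
  rintro v ⟨h, x, h0, -, hx, hxh, rfl⟩
  refine abs_kdiff_le fun i hi => hM _ ⟨?_, ?_⟩
  · have : 0 ≤ (i : ℝ) * h := by positivity
    linarith
  · have : (i : ℝ) * h ≤ k * h := mul_le_mul_of_nonneg_right (by exact_mod_cast hi) h0.le
    linarith

/-- **Whitney's inequality** on an arbitrary interval. -/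
theorem exists_polynomial_abs_sub_le_omegaK {k : ℕ} (hk : 1 ≤ k) :
    ∃ C : ℝ, 0 < C ∧ ∀ (a b : ℝ), a < b → ∀ g : ℝ → ℝ, ContinuousOn g (Set.Icc a b) →
      ∃ q : Polynomial ℝ, q.natDegree ≤ k - 1 ∧
        ∀ x ∈ Set.Icc a b, |g x - q.eval x| ≤ C * omegaK g k (b - a) a b := by
  obtain ⟨C, hC, hmain⟩ := exists_abs_le_mul_of_vanishing hk
  refine ⟨C, hC, fun a b hab g hg => ?_⟩
  have hk0 : (0 : ℝ) < k := by exact_mod_cast hk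
  have hba : 0 < b - a := sub_pos.2 hab
  set v : ℕ → ℝ := fun i => (i : ℝ) / k with hv
  have hvi : Function.Injective v := fun i j hij => by
    simpa [hv, div_left_inj' hk0.ne'] using hij
  set G : ℝ → ℝ := fun t => g (a + t * (b - a)) with hG
  set P := Lagrange.interpolate (Finset.range k) v (fun i => G (v i)) with hP
  have hPd : P.degree < k := by
    simpa only [Finset.card_range] using Lagrange.degree_interpolate_lt (fun i => G (v i))
      (hvi.injOn (s := (Finset.range k : Set ℕ)))
  have hPn : P.natDegree < k := by
    by_cases h0 : P = 0
    · rw [h0]; exact hk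
    · exact (Polynomial.natDegree_lt_iff_degree_lt h0).2 hPd
  have hmaps : Set.MapsTo (fun t : ℝ => a + t * (b - a)) (Set.Icc 0 1) (Set.Icc a b) := by
    rintro t ⟨h0, h1⟩
    exact ⟨by nlinarith, by nlinarith⟩
  have hcont : ContinuousOn (fun t => G t - P.eval t) (Set.Icc 0 1) :=
    (hg.comp (by fun_prop) hmaps).sub P.continuous.continuousOn
  have hdiff : ∀ x h : ℝ, 0 ≤ x → 0 < h → x + k * h ≤ 1 →
      |kdiff k (fun t => G t - P.eval t) x h| ≤ omegaK g k (b - a) a b := by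
    intro x h hx hh hxh
    have e : kdiff k G x h = kdiff k g (a + x * (b - a)) (h * (b - a)) := by
      refine Finset.sum_congr rfl fun i _ => ?_
      simp only [hG]
      congr 2
      ring
    have hk1 : (1 : ℝ) ≤ k := by exact_mod_cast hk
    rw [kdiff_sub, kdiff_eval_eq_zero hPn, sub_zero, e]
    refine abs_kdiff_le_omegaK hg (by positivity) ?_ ?_ ?_
    · nlinarith
    · nlinarith
    · nlinarith
  have hzero : ∀ i < k, G ((i : ℝ) / k) - P.eval ((i : ℝ) / k) = 0 := fun i hi =>
    sub_eq_zero.2 (Lagrange.eval_interpolate_at_node (fun i => G (v i)) hvi.injOn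
      (Finset.mem_range.2 hi)).symm
  refine ⟨P.comp (Polynomial.C (1 / (b - a)) * Polynomial.X + Polynomial.C (-a / (b - a))),
    ?_, fun x hx => ?_⟩
  · refine (Polynomial.natDegree_comp_le.trans
      (Nat.mul_le_mul_left _ Polynomial.natDegree_linear_le)).trans ?_
    omega
  · have := hmain _ _ hcont hdiff hzero ((x - a) / (b - a))
      ⟨div_nonneg (by linarith [hx.1]) hba.le, by rw [div_le_one hba]; linarith [hx.2]⟩
    have e1 : a + (x - a) / (b - a) * (b - a) = x := by rw [div_mul_cancel₀ _ hba.ne']; ring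
    have e2 : 1 / (b - a) * x + -a / (b - a) = (x - a) / (b - a) := by ring
    simpa only [hG, e1, Polynomial.eval_comp, Polynomial.eval_add, Polynomial.eval_mul,
      Polynomial.eval_C, Polynomial.eval_X, e2] using this

lemma exists_derivative_eq (p : Polynomial ℝ) :
    ∃ P : Polynomial ℝ, P.derivative = p ∧ P.natDegree ≤ p.natDegree + 1 := by
  refine ⟨∑ i ∈ Finset.range (p.natDegree + 1),
    Polynomial.monomial (i + 1) (p.coeff i / ((i : ℝ) + 1)), ?_, ?_⟩
  · rw [Polynomial.derivative_sum]
    conv_rhs => rw [p.as_sum_range]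
    refine Finset.sum_congr rfl fun i _ => ?_
    rw [Polynomial.derivative_monomial, Nat.add_sub_cancel, Nat.cast_succ,
      div_mul_cancel₀ _ (by positivity)]
  · refine Polynomial.natDegree_sum_le_of_forall_le _ _ fun i hi => ?_
    exact (Polynomial.natDegree_monomial_le _).trans (Finset.mem_range.1 hi)

/-- Integrating a onesided approximation `Q` of `f⁽ʳ⁾` repeatedly from `lam` produces an
intertwining approximation of `f`. -/
lemma exists_polynomial_intertwining {a b lam D : ℝ} (hab : a < b) (hlam : lam ∈ Set.Icc a b)
    (Q : Polynomial ℝ) (r : ℕ) :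
    ∀ f : ℝ → ℝ, ContDiffOn ℝ r f (Set.Icc a b) →
      (∀ x ∈ Set.Icc a b, 0 ≤ Q.eval x - iteratedDerivWithin r f (Set.Icc a b) x ∧
        Q.eval x - iteratedDerivWithin r f (Set.Icc a b) x ≤ D) →
      ∃ p : Polynomial ℝ, p.natDegree ≤ Q.natDegree + r ∧
        (∀ i < r, (Polynomial.derivative^[i] p).eval lam
          = iteratedDerivWithin i f (Set.Icc a b) lam) ∧
        (∀ x ∈ Set.Icc lam b, 0 ≤ p.eval x - f x ∧ p.eval x - f x ≤ (b - a) ^ r * D) ∧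
        (∀ x ∈ Set.Icc a lam, 0 ≤ (-1 : ℝ) ^ r * (p.eval x - f x) ∧
          (-1 : ℝ) ^ r * (p.eval x - f x) ≤ (b - a) ^ r * D) := by
  have hba : 0 < b - a := sub_pos.2 hab
  induction r with
  | zero =>
    intro f _ hQ
    simp only [iteratedDerivWithin_zero] at hQ
    refine ⟨Q, le_rfl, by simp, fun x hx => ?_, fun x hx => ?_⟩
    · simpa using hQ x ⟨hlam.1.trans hx.1, hx.2⟩
    · simpa using hQ x ⟨hx.1, hx.2.trans hlam.2⟩
  | succ r ih =>
    intro f hf hQ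
    rw [Nat.cast_succ, contDiffOn_succ_iff_derivWithin (uniqueDiffOn_Icc hab)] at hf
    obtain ⟨hfd, -, hf'⟩ := hf
    simp only [iteratedDerivWithin_succ'] at hQ
    obtain ⟨p₁, hdeg, hint, hright, hleft⟩ := ih _ hf' hQ
    have hD : 0 ≤ (b - a) ^ r * D := mul_nonneg (by positivity)
      ((hQ lam hlam).1.trans (hQ lam hlam).2)
    obtain ⟨P, hP, hPdeg⟩ := exists_derivative_eq p₁
    set p := P + Polynomial.C (f lam - P.eval lam) with hp
    have hpd : p.derivative = p₁ := by simp [hp, hP]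
    have hplam : p.eval lam = f lam := by simp [hp]
    set E : ℝ → ℝ := fun x => p.eval x - f x with hE
    have hElam : E lam = 0 := by simp [hE, hplam]
    have hder : ∀ x ∈ Set.Icc a b,
        HasDerivWithinAt E (p₁.eval x - derivWithin f (Set.Icc a b) x) (Set.Icc a b) x := by
      intro x hx
      refine HasDerivWithinAt.sub ?_ (hfd x hx).hasDerivWithinAt
      rw [← hpd]
      exact (p.hasDerivAt x).hasDerivWithinAt
    have hrsub : Set.Icc lam b ⊆ Set.Icc a b := Set.Icc_subset_Icc_left hlam.1
    have hlsub : Set.Icc a lam ⊆ Set.Icc a b := Set.Icc_subset_Icc_right hlam.2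
    have mono : ∀ {u v c : ℝ}, Set.Icc u v ⊆ Set.Icc a b →
        (∀ x ∈ Set.Icc u v, 0 ≤ c * (p₁.eval x - derivWithin f (Set.Icc a b) x)) →
        MonotoneOn (fun x => c * E x) (Set.Icc u v) := by
      intro u v c hs hc
      have hd : ∀ x ∈ Set.Icc u v, HasDerivWithinAt (fun x => c * E x)
          (c * (p₁.eval x - derivWithin f (Set.Icc a b) x)) (Set.Icc u v) x :=
        fun x hx => ((hder x (hs hx)).mono hs).const_mul c
      refine monotoneOn_of_hasDerivWithinAt_nonneg (convex_Icc u v)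
        (fun x hx => (hd x hx).continuousWithinAt)
        (fun x hx => (hd x (interior_subset hx)).mono interior_subset)
        (fun x hx => hc x (interior_subset hx))
    have bound : ∀ {u v : ℝ}, Set.Icc u v ⊆ Set.Icc a b →
        (∀ x ∈ Set.Icc u v, |p₁.eval x - derivWithin f (Set.Icc a b) x| ≤ (b - a) ^ r * D) →
        lam ∈ Set.Icc u v → ∀ x ∈ Set.Icc u v, |E x| ≤ (b - a) ^ (r + 1) * D := by
      intro u v hs hc hl x hx
      have h1 := (convex_Icc u v).norm_image_sub_le_of_norm_hasDerivWithin_le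
        (fun y hy => (hder y (hs hy)).mono hs) hc hl hx
      rw [hElam, sub_zero, Real.norm_eq_abs, Real.norm_eq_abs] at h1
      have h2 : |x - lam| ≤ b - a := by
        rw [abs_le]
        constructor <;> linarith [(hs hx).1, (hs hx).2, hlam.1, hlam.2]
      calc |E x| ≤ (b - a) ^ r * D * (b - a) := h1.trans (mul_le_mul_of_nonneg_left h2 hD)
        _ = _ := by ring
    refine ⟨p, ?_, fun i hi => ?_, fun x hx => ⟨?_, ?_⟩, fun x hx => ⟨?_, ?_⟩⟩
    · rw [hp, Polynomial.natDegree_add_C]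
      omega
    · cases i with
      | zero => simpa using hplam
      | succ i =>
        rw [Function.iterate_succ_apply, hpd, iteratedDerivWithin_succ']
        exact hint i (by omega)
    · have := mono (c := 1) hrsub (fun y hy => by simpa using (hright y hy).1)
        ⟨le_rfl, hlam.2⟩ hx hx.1
      simp only [hElam, one_mul] at this
      exact this
    · refine (le_abs_self _).trans (bound hrsub (fun y hy => ?_) ⟨le_rfl, hlam.2⟩ x hx)
      rw [abs_of_nonneg (hright y hy).1]
      exact (hright y hy).2
    · have := mono (c := (-1) ^ r) hlsub (fun y hy => (hleft y hy).1)
        hx ⟨hlam.1, le_rfl⟩ hx.2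
      simp only [hElam, mul_zero] at this
      rw [pow_succ, mul_neg_one, neg_mul]
      exact neg_nonneg.2 this
    · refine (le_abs_self _).trans ?_
      rw [abs_mul, abs_pow, abs_neg, abs_one, one_pow, one_mul]
      refine bound hlsub (fun y hy => ?_) ⟨hlam.1, le_rfl⟩ x hx
      have := (hleft y hy).2
      rw [← abs_of_nonneg (hleft y hy).1, abs_mul, abs_pow, abs_neg, abs_one, one_pow,
        one_mul] at this
      exact this
/-- Local onesided/intertwining approximation with interpolatory constraints for
`f ∈ C^r[a,b]`: there is `c = c(k,r) > 0` such that for every interval `[a,b]`, every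
`f ∈ C^r[a,b]` and every `λ ∈ [a,b]` there is a polynomial `p` of degree ≤ k + r - 1
with `p^{(i)}(λ) = f^{(i)}(λ)` for `0 ≤ i ≤ r - 1`,
`‖f - p‖_{[a,b]} ≤ c (b-a)^r ω_k(f^{(r)}, b-a; [a,b])`, and the sign conditions:
if `λ ∈ (a,b)` then `p - f ≥ 0` on `[λ,b]` and `(-1)^r (p - f) ≥ 0` on `[a,λ]`;
if `λ = a` then `p - f ≥ 0` on `[a,b]`; if `λ = b` then `(-1)^r (p - f) ≥ 0` on `[a,b]`. -/
theorem statement19 (r k : ℕ) (hr : 1 ≤ r) (hk : 1 ≤ k) :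
    ∃ c : ℝ, 0 < c ∧ ∀ a b : ℝ, a < b →
      ∀ f : ℝ → ℝ, ContDiffOn ℝ r f (Set.Icc a b) →
      ∀ lam ∈ Set.Icc a b,
      ∃ p : Polynomial ℝ, p.natDegree ≤ k + r - 1 ∧
        (∀ i : ℕ, i ≤ r - 1 → (Polynomial.derivative^[i] p).eval lam
            = iteratedDerivWithin i f (Set.Icc a b) lam) ∧
        (∀ x ∈ Set.Icc a b, |f x - p.eval x| ≤
          c * (b - a) ^ r * omegaK (iteratedDerivWithin r f (Set.Icc a b)) k (b - a) a b) ∧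
        (lam ∈ Set.Ioo a b →
          (∀ x ∈ Set.Icc lam b, f x ≤ p.eval x) ∧
          (∀ x ∈ Set.Icc a lam, 0 ≤ (-1 : ℝ) ^ r * (p.eval x - f x))) ∧
        (lam = a → ∀ x ∈ Set.Icc a b, f x ≤ p.eval x) ∧
        (lam = b → ∀ x ∈ Set.Icc a b, 0 ≤ (-1 : ℝ) ^ r * (p.eval x - f x)) := by
  obtain ⟨C, hC, hW⟩ := exists_polynomial_abs_sub_le_omegaK hk
  refine ⟨2 * C, by positivity, fun a b hab f hf lam hlam => ?_⟩
  set ω := omegaK (iteratedDerivWithin r f (Set.Icc a b)) k (b - a) a b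
  obtain ⟨q, hq, hqb⟩ := hW a b hab _
    (hf.continuousOn_iteratedDerivWithin le_rfl (uniqueDiffOn_Icc hab))
  obtain ⟨p, hdeg, hint, hright, hleft⟩ := exists_polynomial_intertwining (D := 2 * (C * ω)) hab
    hlam (q + Polynomial.C (C * ω)) r f hf (fun x hx => by
      have := abs_le.1 (hqb x hx)
      simp only [Polynomial.eval_add, Polynomial.eval_C]
      constructor <;> linarith)
  rw [Polynomial.natDegree_add_C] at hdeg
  refine ⟨p, by omega, fun i hi => hint i (by omega), fun x hx => ?_, fun _ =>
    ⟨fun x hx => sub_nonneg.1 (hright x hx).1, fun x hx => (hleft x hx).1⟩, ?_, ?_⟩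
  · rw [abs_sub_comm, show 2 * C * (b - a) ^ r * ω = (b - a) ^ r * (2 * (C * ω)) by ring]
    rcases le_total lam x with h | h
    · rw [abs_of_nonneg (hright x ⟨h, hx.2⟩).1]
      exact (hright x ⟨h, hx.2⟩).2
    · have h1 := hleft x ⟨hx.1, h⟩
      rw [← abs_of_nonneg h1.1, abs_mul, abs_pow, abs_neg, abs_one, one_pow, one_mul] at h1
      exact h1.2
  · rintro rfl x hx
    exact sub_nonneg.1 (hright x hx).1
  · rintro rfl x hx
    exact (hleft x hx).1
end
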